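/- (Restricted weak-type estimate) For every ε > 0 there exists a constant C_ε > 0 such that for every δ ∈ (0,1), every Lebesgue measurable set E ⊂ ℝ³ of finite measure, and every α > 0: α^{10/3} · σ({ξ ∈ S² : (χ_E)*_δ(ξ) > α}) ≤ (C_ε δ^{-1/5-ε} |E|^{2/5})^{10/3}; equivalently, ‖(χ_E)*_δ‖_{L^{10/3,∞}(S²)} ≤ C_ε δ^{-1/5-ε} |E|^{2/5}. -/

import Mathlib

open MeasureTheory Metric Set
open scoped ENNReal RealInnerProductSpace

noncomputable section

/-- The `δ`-tube centered at `a` in direction `ξ`: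
`T^δ_ξ(a) = {x : |(x−a)·ξ| ≤ 1/2, |(x−a) − ((x−a)·ξ)ξ| ≤ δ}`. -/
def tube (d : ℕ) (δ : ℝ) (ξ a : EuclideanSpace ℝ (Fin d)) : Set (EuclideanSpace ℝ (Fin d)) :=
  {x | abs ⟪x - a, ξ⟫ ≤ 1 / 2 ∧ ‖(x - a) - ⟪x - a, ξ⟫ • ξ‖ ≤ δ}

/-- The Kakeya maximal function `f*_δ(ξ) = sup_a |T^δ_ξ(a)|⁻¹ ∫_{T^δ_ξ(a)} |f|`. -/
def kakeyaMax (d : ℕ) (δ : ℝ) (f : EuclideanSpace ℝ (Fin d) → ℝ)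
    (ξ : EuclideanSpace ℝ (Fin d)) : ℝ≥0∞ :=
  ⨆ a : EuclideanSpace ℝ (Fin d),
    (∫⁻ x in tube d δ ξ a, ENNReal.ofReal |f x|) / volume (tube d δ ξ a)

/-- The surface measure on the unit sphere `S^{d-1} ⊆ ℝ^d`, realized as the
`(d-1)`-dimensional Hausdorff measure restricted to the sphere. -/
def sphereMeasure (d : ℕ) : Measure (EuclideanSpace ℝ (Fin d)) :=
  (μH[(d : ℝ) - 1]).restrict (sphere (0 : EuclideanSpace ℝ (Fin d)) 1)

namespace Kak

/-! ### signatures -/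
section sig
open Classical
variable {Ω ι : Type*} [Fintype ι]

def sig (Y : ι → Set Ω) (x : Ω) : Finset ι := Finset.univ.filter fun i => x ∈ Y i

lemma mem_sig (Y : ι → Set Ω) (x : Ω) (i : ι) : i ∈ sig Y x ↔ x ∈ Y i := by simp [sig]

variable [MeasurableSpace Ω]

lemma meas_sig_eq {Y : ι → Set Ω} (hY : ∀ i, MeasurableSet (Y i)) (s : Finset ι) :
    MeasurableSet {x | sig Y x = s} := by
  have : {x | sig Y x = s} = ⋂ i, {x | x ∈ Y i ↔ i ∈ s} := by
    ext x
    simp only [Set.mem_ofPred_eq, Set.mem_iInter, Finset.ext_iff, mem_sig]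
  rw [this]
  refine MeasurableSet.iInter fun i => ?_
  by_cases h : i ∈ s
  · have : {x | x ∈ Y i ↔ i ∈ s} = Y i := by ext x; simp [h]
    rw [this]; exact hY i
  · have : {x | x ∈ Y i ↔ i ∈ s} = (Y i)ᶜ := by ext x; simp [h]
    rw [this]; exact (hY i).compl

lemma meas_sig {Y : ι → Set Ω} (hY : ∀ i, MeasurableSet (Y i)) (p : Finset ι → Prop) :
    MeasurableSet {x | p (sig Y x)} := by
  have : {x | p (sig Y x)} = ⋃ s : {s : Finset ι // p s}, {x | sig Y x = s} := by
    ext x; simp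
  rw [this]
  exact MeasurableSet.iUnion fun s => meas_sig_eq hY _

lemma real_sig {Y : ι → Set Ω} (hY : ∀ i, MeasurableSet (Y i)) (μ : Measure Ω) [IsFiniteMeasure μ]
    (p : Finset ι → Prop) [DecidablePred p] :
    μ.real {x | p (sig Y x)} = ∑ s, if p s then μ.real {x | sig Y x = s} else 0 := by
  have h : {x | p (sig Y x)} = ⋃ s ∈ Finset.univ.filter p, {x | sig Y x = s} := by
    ext x; simp
  rw [h, measureReal_biUnion_finset, Finset.sum_filter]
  · intro s _ t _ hst
    refine Set.disjoint_left.2 fun x hx hy => hst ?_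
    simp only [Set.mem_ofPred_eq] at hx hy
    rw [← hx, ← hy]
  · intro s _; exact meas_sig_eq hY s

/-- Cauchy–Schwarz for finite families of sets. -/
lemma cs_sets {Y : ι → Set Ω} (hY : ∀ i, MeasurableSet (Y i)) (μ : Measure Ω) [IsFiniteMeasure μ]
    (F : Set Ω) (hF : ∀ i, Y i ⊆ F) :
    (∑ i, μ.real (Y i)) ^ 2 ≤ μ.real F * ∑ i, ∑ j, μ.real (Y i ∩ Y j) := by
  set w : Finset ι → ℝ := fun s => μ.real {x | sig Y x = s} with hw
  have w0 : ∀ s, 0 ≤ w s := fun s => measureReal_nonneg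
  have h1 : ∑ i, μ.real (Y i) = ∑ s, (if s.Nonempty then w s else 0) * (s.card : ℝ) := by
    have : ∀ i, μ.real (Y i) = ∑ s, if i ∈ s then w s else 0 := by
      intro i
      refine Eq.trans ?_ (real_sig hY μ (fun s => i ∈ s))
      congr 1; ext x; simp [mem_sig]
    simp_rw [this]
    rw [Finset.sum_comm]
    refine Finset.sum_congr rfl fun s _ => ?_
    rw [← Finset.sum_filter, Finset.sum_const]
    by_cases hs : s.Nonempty
    · simp [hs, mul_comm]
    · simp [Finset.not_nonempty_iff_eq_empty.1 hs]
  have h2 : ∑ i, ∑ j, μ.real (Y i ∩ Y j) =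
      ∑ s, (if s.Nonempty then w s else 0) * (s.card : ℝ) ^ 2 := by
    have : ∀ i j, μ.real (Y i ∩ Y j) = ∑ s, if i ∈ s ∧ j ∈ s then w s else 0 := by
      intro i j
      refine Eq.trans ?_ (real_sig hY μ (fun s => i ∈ s ∧ j ∈ s))
      congr 1; ext x; simp [mem_sig]
    simp_rw [this]
    rw [← Finset.sum_product', Finset.sum_comm]
    refine Finset.sum_congr rfl fun s _ => ?_
    have : ((Finset.univ ×ˢ Finset.univ).filter fun x : ι × ι => x.1 ∈ s ∧ x.2 ∈ s) = s ×ˢ s := by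
      ext x; simp
    rw [← Finset.sum_filter, Finset.sum_const, this, Finset.card_product]
    by_cases hs : s.Nonempty
    · simp [hs]; ring
    · simp [Finset.not_nonempty_iff_eq_empty.1 hs]
  have h3 : ∑ s, (if s.Nonempty then w s else 0) ≤ μ.real F := by
    refine (real_sig hY μ (fun s => s.Nonempty)).symm.trans_le ?_
    refine measureReal_mono ?_
    rintro x ⟨i, hi⟩
    exact hF i ((mem_sig _ _ _).1 hi)
  rw [h1, h2]
  have w1 : ∀ s : Finset ι, 0 ≤ (if s.Nonempty then w s else 0) := by
    intro s; split_ifs; exact w0 s; exact le_rfl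
  calc _ ≤ (∑ s, (if s.Nonempty then w s else 0)) *
        ∑ s, (if s.Nonempty then w s else 0) * (s.card : ℝ) ^ 2 := by
        refine Finset.sum_sq_le_sum_mul_sum_of_sq_le_mul _ (fun s _ => w1 s) (fun s _ => ?_)
          (fun s _ => le_of_eq (by ring))
        exact mul_nonneg (w1 s) (sq_nonneg _)
    _ ≤ _ := by
        refine mul_le_mul_of_nonneg_right h3 (Finset.sum_nonneg fun s _ => ?_)
        exact mul_nonneg (w1 s) (sq_nonneg _)
end sig

/-! ### the combinatorial core -/
section comb
open Classical
variable {ι Γ : Type*}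

lemma exists_cell [Inhabited Γ] (c : ℕ → ι → Γ) (hc0 : ∀ i j, c 0 i = c 0 j) (K : ℕ) (β : ℝ)
    (hβ : 1 ≤ β) (s : Finset ι) :
    ∃ k γ, k ≤ K ∧ (s.card : ℝ) ≤ β ^ K * ((s.filter fun i => c k i = γ).card : ℝ) ∧
      ∀ j ≤ K, ∀ γ', β ^ j * ((s.filter fun i => c j i = γ').card : ℝ) ≤
        β ^ k * ((s.filter fun i => c k i = γ).card : ℝ) := by
  rcases s.eq_empty_or_nonempty with rfl | hs
  · exact ⟨0, default, by simp, by simp, by simp⟩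
  obtain ⟨⟨k, i⟩, hm, hmax⟩ := Finset.exists_max_image (Finset.range (K+1) ×ˢ s)
    (fun q : ℕ × ι => β ^ q.1 * ((s.filter fun i => c q.1 i = c q.1 q.2).card : ℝ))
    ((Finset.nonempty_range_iff.2 (by omega)).product hs)
  simp only [Finset.mem_product, Finset.mem_range] at hm hmax
  refine ⟨k, c k i, by omega, ?_, ?_⟩
  · have := hmax (0, i) ⟨by simp, hm.2⟩
    simp only [pow_zero, one_mul] at this
    have e : (s.filter fun j => c 0 j = c 0 i) = s := Finset.filter_true_of_mem fun j _ => hc0 _ _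
    rw [e] at this
    refine this.trans ?_
    gcongr
    omega
  · intro j hj γ'
    rcases (s.filter fun i => c j i = γ').eq_empty_or_nonempty with h | ⟨i', hi'⟩
    · rw [h]; simp; positivity
    · obtain ⟨h1, rfl⟩ := Finset.mem_filter.1 hi'
      exact hmax (j, i') ⟨by simp; omega, h1⟩

/-- The combinatorial pruning argument. -/
lemma comb_main [Fintype ι] (w : Finset ι → ℝ) (hw : ∀ s, 0 ≤ w s) (K : ℕ)
    (k : Finset ι → ℕ) (γ : Finset ι → Γ) (a τ B : ℝ) (ha : 0 ≤ a)
    (hk : ∀ s, k s ≤ K)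
    (so sg : Finset ι → Finset ι)
    (y : ι → ℝ) (hy : ∀ i, y i = ∑ s, if i ∈ s then w s else 0)
    (m : ι → ℕ → ℝ) (hm : ∀ i l, m i l = ∑ s, if i ∈ so s ∧ k s = l then w s else 0)
    (hsg : ∀ s, sg s = (so s).filter fun i => τ * y i ≤ m i (k s))
    (hcard : ∀ s, a * (s.card : ℝ) ≤ (so s).card)
    (hτ : 2 * (K + 1) * τ ≤ a)
    (hB : ∀ l g, (∑ s, if k s = l ∧ γ s = g ∧ (so s).card ≤ 4 * (sg s).card then
        w s * ((sg s).card : ℝ) ^ 2 else 0) ≤ B * ∑ s, if k s = l ∧ γ s = g then w s else 0) :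
    (a * ∑ i, y i) ^ 2 ≤ 16 * B * (∑ s, w s) ^ 2 := by
  have y0 : ∀ i, 0 ≤ y i := fun i => by
    rw [hy]; exact Finset.sum_nonneg fun s _ => by split_ifs; exact hw s; exact le_rfl
  have W0 : 0 ≤ ∑ s, w s := Finset.sum_nonneg fun s _ => hw s
  have hyS : ∑ i, y i = ∑ s, w s * (s.card : ℝ) := by
    simp_rw [hy]
    rw [Finset.sum_comm]
    refine Finset.sum_congr rfl fun s _ => ?_
    rw [← Finset.sum_filter, Finset.sum_const]; simp [mul_comm]
  set I := ∑ s, w s * ((so s).card : ℝ) with hI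
  have hI1 : a * ∑ i, y i ≤ I := by
    rw [hyS, Finset.mul_sum]
    refine Finset.sum_le_sum fun s _ => ?_
    nlinarith [mul_le_mul_of_nonneg_left (hcard s) (hw s)]
  have hI0 : 0 ≤ a * ∑ i, y i := mul_nonneg ha (Finset.sum_nonneg fun i _ => y0 i)
  -- bad part
  have hbad : ∑ s, w s * (((so s) \ (sg s)).card : ℝ) ≤ I / 2 := by
    have e1 : ∑ s, w s * (((so s) \ (sg s)).card : ℝ) =
        ∑ i, ∑ l ∈ Finset.range (K+1), if m i l < τ * y i then m i l else 0 := by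
      have e2 : ∀ i, ∀ l, (if m i l < τ * y i then m i l else 0) =
          ∑ s, if i ∈ so s ∧ k s = l ∧ m i (k s) < τ * y i then w s else 0 := by
        intro i l
        split_ifs with h
        · rw [hm]
          refine Finset.sum_congr rfl fun s _ => ?_
          refine if_congr ?_ rfl rfl
          constructor
          · rintro ⟨h1, rfl⟩; exact ⟨h1, rfl, h⟩
          · rintro ⟨h1, h2, _⟩; exact ⟨h1, h2⟩
        · symm
          refine Finset.sum_eq_zero fun s _ => if_neg ?_
          rintro ⟨_, rfl, h2⟩; exact h h2
      simp_rw [e2]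
      have e3 : ∀ i, ∑ l ∈ Finset.range (K+1), ∑ s, (if i ∈ so s ∧ k s = l ∧ m i (k s) < τ * y i
          then w s else 0) = ∑ s, if i ∈ so s \ sg s then w s else 0 := by
        intro i
        rw [Finset.sum_comm]
        refine Finset.sum_congr rfl fun s _ => ?_
        rw [Finset.sum_eq_single (k s)]
        · refine if_congr ?_ rfl rfl
          rw [Finset.mem_sdiff, hsg, Finset.mem_filter]
          simp only [not_and, not_le, true_and]
          tauto
        · intro l _ hl
          rw [if_neg]; rintro ⟨_, h, _⟩; exact hl h.symm
        · intro h; exact absurd (Finset.mem_range.2 (Nat.lt_succ_of_le (hk s))) h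
      simp_rw [e3]
      rw [Finset.sum_comm]
      refine Finset.sum_congr rfl fun s _ => ?_
      rw [← Finset.sum_filter, Finset.sum_const, Finset.filter_univ_mem]; simp [mul_comm]
    rw [e1]
    have e4 : ∀ i, (∑ l ∈ Finset.range (K+1), if m i l < τ * y i then m i l else 0) ≤
        (K+1) * (τ * y i) ∨ τ < 0 := by
      intro i
      by_cases ht : τ < 0
      · exact Or.inr ht
      left
      calc _ ≤ ∑ l ∈ Finset.range (K+1), τ * y i := by
            refine Finset.sum_le_sum fun l _ => ?_
            split_ifs with h
            · exact h.le
            · exact mul_nonneg (not_lt.1 ht) (y0 i)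
        _ = _ := by simp
    by_cases ht : τ < 0
    · have m0 : ∀ i l, 0 ≤ m i l := fun i l => by
        rw [hm]; exact Finset.sum_nonneg fun s _ => by split_ifs; exact hw s; exact le_rfl
      have : ∑ i, ∑ l ∈ Finset.range (K+1), (if m i l < τ * y i then m i l else 0) = 0 := by
        refine Finset.sum_eq_zero fun i _ => Finset.sum_eq_zero fun l _ => if_neg ?_
        rw [not_lt]
        nlinarith [m0 i l, y0 i]
      rw [this]; linarith
    · calc _ ≤ ∑ i, (K+1) * (τ * y i) := Finset.sum_le_sum fun i _ => (e4 i).resolve_right ht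
        _ = ((K+1) * τ) * ∑ i, y i := by rw [Finset.mul_sum]; simp_rw [mul_assoc]
        _ ≤ (a / 2) * ∑ i, y i := by
            refine mul_le_mul_of_nonneg_right (by linarith) (Finset.sum_nonneg fun i _ => y0 i)
        _ ≤ I / 2 := by linarith
  have hgood : I / 2 ≤ ∑ s, w s * ((sg s).card : ℝ) := by
    have : I = ∑ s, w s * (((so s) \ (sg s)).card : ℝ) + ∑ s, w s * ((sg s).card : ℝ) := by
      rw [hI, ← Finset.sum_add_distrib]
      refine Finset.sum_congr rfl fun s _ => ?_
      have hsub : sg s ⊆ so s := by rw [hsg]; exact Finset.filter_subset _ _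
      have := Finset.card_sdiff_add_card_eq_card hsub
      rw [← this]; push_cast; ring
    linarith
  set v : Finset ι → ℝ := fun s => if (so s).card ≤ 4 * (sg s).card then w s else 0 with hv
  have v0 : ∀ s, 0 ≤ v s := fun s => by simp only [hv]; split_ifs; exact hw s; exact le_rfl
  have hv1 : ∀ s, v s ≤ w s := fun s => by simp only [hv]; split_ifs; exact le_rfl; exact hw s
  have hgood2 : I / 4 ≤ ∑ s, v s * ((sg s).card : ℝ) := by
    have : ∑ s, w s * ((sg s).card : ℝ) ≤ ∑ s, v s * ((sg s).card : ℝ) + I / 4 := by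
      rw [hI, Finset.sum_div, ← Finset.sum_add_distrib]
      refine Finset.sum_le_sum fun s _ => ?_
      simp only [hv]
      split_ifs with h
      · have := mul_nonneg (hw s) (Nat.cast_nonneg (α := ℝ) (so s).card); linarith
      · have h' : (4 * (sg s).card : ℝ) ≤ (so s).card := by exact_mod_cast (not_le.1 h).le
        nlinarith [hw s]
    linarith
  have hcs : (∑ s, v s * ((sg s).card : ℝ)) ^ 2 ≤ (∑ s, v s) * ∑ s, v s * ((sg s).card : ℝ) ^ 2 :=
    Finset.sum_sq_le_sum_mul_sum_of_sq_le_mul _ (fun s _ => v0 s)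
      (fun s _ => mul_nonneg (v0 s) (sq_nonneg _)) (fun s _ => le_of_eq (by ring))
  have hvW : ∑ s, v s ≤ ∑ s, w s := Finset.sum_le_sum fun s _ => hv1 s
  have hq0 : 0 ≤ ∑ s, v s * ((sg s).card : ℝ) ^ 2 :=
    Finset.sum_nonneg fun s _ => mul_nonneg (v0 s) (sq_nonneg _)
  have hfin : ∑ s, v s * ((sg s).card : ℝ) ^ 2 ≤ B * ∑ s, w s := by
    have key : ∀ f : Finset ι → ℝ, ∑ s, f s =
        ∑ q ∈ Finset.univ.image (fun s => (k s, γ s)), ∑ s, if k s = q.1 ∧ γ s = q.2 then f s else 0 := by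
      intro f
      rw [← Finset.sum_fiberwise_of_maps_to (g := fun s => (k s, γ s))
        (t := Finset.univ.image (fun s => (k s, γ s))) (fun s hs => Finset.mem_image_of_mem _ hs)]
      refine Finset.sum_congr rfl fun q _ => ?_
      rw [Finset.sum_filter]
      refine Finset.sum_congr rfl fun s _ => if_congr ?_ rfl rfl
      rw [Prod.ext_iff]
    rw [key, key w, Finset.mul_sum]
    refine Finset.sum_le_sum fun q _ => ?_
    refine le_trans (le_of_eq ?_) (hB q.1 q.2)
    refine Finset.sum_congr rfl fun s _ => ?_
    simp only [hv]
    by_cases h1 : k s = q.1 ∧ γ s = q.2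
    · by_cases h2 : (so s).card ≤ 4 * (sg s).card <;> simp [h1, h2]
    · rw [if_neg h1, if_neg (by tauto)]
  have h5 : (I / 4) ^ 2 ≤ (∑ s, w s) * (B * ∑ s, w s) := by
    calc (I / 4) ^ 2 ≤ (∑ s, v s * ((sg s).card : ℝ)) ^ 2 := by
          apply pow_le_pow_left₀ _ hgood2; linarith
      _ ≤ _ := hcs
      _ ≤ _ := mul_le_mul hvW hfin hq0 W0
  have h6 : (a * ∑ i, y i) ^ 2 ≤ I ^ 2 := pow_le_pow_left₀ hI0 hI1 2
  nlinarith
end comb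

/-! ### volumes of tubes -/

def tb (δ t0 v1 b1 v2 b2 : ℝ) : Set (ℝ × ℝ × ℝ) :=
  {p | t0 ≤ p.1 ∧ p.1 < t0 + 4 ∧ |p.2.1 - b1 - p.1 * v1| ≤ 3 * δ ∧ |p.2.2 - b2 - p.1 * v2| ≤ 3 * δ}

lemma vol_box (A : Set ℝ) (hA : MeasurableSet A) (g1 g2 : ℝ → ℝ) (h1 : Measurable g1)
    (h2 : Measurable g2) (w : ℝ) (hw : 0 ≤ w) :
    volume {p : ℝ × ℝ × ℝ | p.1 ∈ A ∧ |p.2.1 - g1 p.1| ≤ w ∧ |p.2.2 - g2 p.1| ≤ w} =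
      ENNReal.ofReal (4 * w ^ 2) * volume A := by
  have hm : MeasurableSet {p : ℝ × ℝ × ℝ | p.1 ∈ A ∧ |p.2.1 - g1 p.1| ≤ w ∧ |p.2.2 - g2 p.1| ≤ w} := by
    have m1 : MeasurableSet {p : ℝ × ℝ × ℝ | |p.2.1 - g1 p.1| ≤ w} :=
      measurableSet_le (by fun_prop) (by fun_prop)
    have m2 : MeasurableSet {p : ℝ × ℝ × ℝ | |p.2.2 - g2 p.1| ≤ w} :=
      measurableSet_le (by fun_prop) (by fun_prop)
    exact (measurable_fst hA).inter (m1.inter m2)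
  rw [Measure.volume_eq_prod, Measure.prod_apply hm]
  have : ∀ t : ℝ, (volume : Measure (ℝ × ℝ)) (Prod.mk t ⁻¹'
      {p : ℝ × ℝ × ℝ | p.1 ∈ A ∧ |p.2.1 - g1 p.1| ≤ w ∧ |p.2.2 - g2 p.1| ≤ w}) =
      A.indicator (fun _ => ENNReal.ofReal (4 * w ^ 2)) t := by
    intro t
    by_cases ht : t ∈ A
    · have e : (Prod.mk t ⁻¹'
        {p : ℝ × ℝ × ℝ | p.1 ∈ A ∧ |p.2.1 - g1 p.1| ≤ w ∧ |p.2.2 - g2 p.1| ≤ w}) =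
          closedBall (g1 t) w ×ˢ closedBall (g2 t) w := by
        ext q; simp [ht, Real.dist_eq]
      rw [e, Measure.volume_eq_prod, Measure.prod_prod, Real.volume_closedBall, Real.volume_closedBall,
        Set.indicator_of_mem ht, ← ENNReal.ofReal_mul (by positivity)]
      congr 1; ring
    · have e : (Prod.mk t ⁻¹'
        {p : ℝ × ℝ × ℝ | p.1 ∈ A ∧ |p.2.1 - g1 p.1| ≤ w ∧ |p.2.2 - g2 p.1| ≤ w}) = ∅ := by
        ext q; simp [ht]
      rw [e, Set.indicator_of_notMem ht]; simp
  simp_rw [this]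
  rw [lintegral_indicator hA]; simp

lemma vol_A (c φ h : ℝ) (hφ : φ ≠ 0) :
    volume {t : ℝ | |c + t * φ| ≤ h} ≤ ENNReal.ofReal (2 * (h / |φ|)) := by
  have : {t : ℝ | |c + t * φ| ≤ h} ⊆ closedBall (-c / φ) (h / |φ|) := by
    intro t ht
    simp only [Set.mem_ofPred_eq] at ht
    rw [mem_closedBall, Real.dist_eq, le_div_iff₀ (abs_pos.2 hφ), ← abs_mul]
    have e : (t - -c / φ) * φ = c + t * φ := by field_simp; ring
    rwa [e]
  exact (measure_mono this).trans (by rw [Real.volume_closedBall])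

lemma vol_inter_aux (δ t0 v1 b1 v2 b2 : ℝ) (hδ : 0 ≤ δ) (A : Set ℝ) (hA : MeasurableSet A)
    (S : Set (ℝ × ℝ × ℝ)) (hS : S ⊆ tb δ t0 v1 b1 v2 b2) (hSA : ∀ p ∈ S, p.1 ∈ A) :
    volume S ≤ ENNReal.ofReal (36 * δ ^ 2) * volume A := by
  have := vol_box A hA (fun t => b1 + t * v1) (fun t => b2 + t * v2) (by fun_prop) (by fun_prop)
    (3 * δ) (by linarith)
  have e : 4 * (3 * δ) ^ 2 = 36 * δ ^ 2 := by ring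
  rw [e] at this
  rw [← this]
  refine measure_mono fun p hp => ?_
  obtain ⟨_, _, h3, h4⟩ := hS hp
  exact ⟨hSA p hp, by rwa [← sub_sub], by rwa [← sub_sub]⟩

lemma vol_slab (δ t0 v1 b1 v2 b2 : ℝ) (hδ : 0 ≤ δ) (x r : ℝ)
    (S : Set (ℝ × ℝ × ℝ)) (hS : S ⊆ tb δ t0 v1 b1 v2 b2) (hSA : ∀ p ∈ S, x ≤ p.1 ∧ p.1 ≤ x + r) :
    volume S ≤ ENNReal.ofReal (36 * δ ^ 2 * r) := by
  refine (vol_inter_aux δ t0 v1 b1 v2 b2 hδ (Icc x (x+r)) measurableSet_Icc S hS hSA).trans ?_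
  rw [Real.volume_Icc, ← ENNReal.ofReal_mul (by positivity)]
  simp

lemma meas_tb (δ t0 v1 b1 v2 b2 : ℝ) : MeasurableSet (tb δ t0 v1 b1 v2 b2) := by
  have m1 : MeasurableSet {p : ℝ × ℝ × ℝ | t0 ≤ p.1} :=
    measurableSet_le (by fun_prop) (by fun_prop)
  have m2 : MeasurableSet {p : ℝ × ℝ × ℝ | p.1 < t0 + 4} :=
    measurableSet_lt (by fun_prop) (by fun_prop)
  have m3 : MeasurableSet {p : ℝ × ℝ × ℝ | |p.2.1 - b1 - p.1 * v1| ≤ 3 * δ} :=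
    measurableSet_le (by fun_prop) (by fun_prop)
  have m4 : MeasurableSet {p : ℝ × ℝ × ℝ | |p.2.2 - b2 - p.1 * v2| ≤ 3 * δ} :=
    measurableSet_le (by fun_prop) (by fun_prop)
  exact m1.inter (m2.inter (m3.inter m4))

lemma tb_inter {δ t0 v1 b1 v2 b2 t0' v1' b1' v2' b2' : ℝ} {p : ℝ × ℝ × ℝ}
    (h : p ∈ tb δ t0 v1 b1 v2 b2) (h' : p ∈ tb δ t0' v1' b1' v2' b2') :
    |b1 - b1' + p.1 * (v1 - v1')| ≤ 6 * δ ∧ |b2 - b2' + p.1 * (v2 - v2')| ≤ 6 * δ := by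
  obtain ⟨_, _, h3, h4⟩ := h
  obtain ⟨_, _, h3', h4'⟩ := h'
  rw [abs_le] at *
  rw [abs_le]
  constructor <;> constructor <;> nlinarith

lemma vol_inter1 (δ t0 v1 b1 v2 b2 t0' v1' b1' v2' b2' : ℝ) (hδ : 0 ≤ δ) (hv : v1 ≠ v1')
    (S : Set (ℝ × ℝ × ℝ)) (hS : S ⊆ tb δ t0 v1 b1 v2 b2) (hS' : S ⊆ tb δ t0' v1' b1' v2' b2') :
    volume S ≤ ENNReal.ofReal (432 * δ ^ 3 / |v1 - v1'|) := by
  refine (vol_inter_aux δ t0 v1 b1 v2 b2 hδ {t | |b1 - b1' + t * (v1 - v1')| ≤ 6 * δ}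
    (measurableSet_le (by fun_prop) (by fun_prop)) S hS (fun p hp => (tb_inter (hS hp) (hS' hp)).1)).trans ?_
  refine (mul_le_mul_right (vol_A _ _ _ (sub_ne_zero.2 hv)) _).trans ?_
  rw [← ENNReal.ofReal_mul (by positivity)]
  apply le_of_eq; congr 1; ring

lemma vol_inter2 (δ t0 v1 b1 v2 b2 t0' v1' b1' v2' b2' : ℝ) (hδ : 0 ≤ δ) (hv : v2 ≠ v2')
    (S : Set (ℝ × ℝ × ℝ)) (hS : S ⊆ tb δ t0 v1 b1 v2 b2) (hS' : S ⊆ tb δ t0' v1' b1' v2' b2') :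
    volume S ≤ ENNReal.ofReal (432 * δ ^ 3 / |v2 - v2'|) := by
  refine (vol_inter_aux δ t0 v1 b1 v2 b2 hδ {t | |b2 - b2' + t * (v2 - v2')| ≤ 6 * δ}
    (measurableSet_le (by fun_prop) (by fun_prop)) S hS (fun p hp => (tb_inter (hS hp) (hS' hp)).2)).trans ?_
  refine (mul_le_mul_right (vol_A _ _ _ (sub_ne_zero.2 hv)) _).trans ?_
  rw [← ENNReal.ofReal_mul (by positivity)]
  apply le_of_eq; congr 1; ring

lemma real_le_of_vol {μ : Measure (ℝ × ℝ × ℝ)} (hμ : μ ≤ volume) {S : Set (ℝ × ℝ × ℝ)} {x : ℝ}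
    (hx : 0 ≤ x) (h : volume S ≤ ENNReal.ofReal x) : μ.real S ≤ x := by
  rw [measureReal_def]
  exact ENNReal.toReal_le_of_le_ofReal hx ((hμ S).trans h)

/-! ### counting -/

lemma card_int_le {ι : Type*} (H : Finset ι) (z : ι → ℤ) (hz : Set.InjOn z H) (x l : ℝ) (hl : 0 ≤ l)
    (h : ∀ i ∈ H, x ≤ z i ∧ (z i : ℝ) ≤ x + l) : (H.card : ℝ) ≤ l + 1 := by
  classical
  rw [← Finset.card_image_of_injOn hz]
  have hsub : H.image z ⊆ Finset.Icc ⌈x⌉ ⌊x + l⌋ := by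
    intro n hn
    obtain ⟨i, hi, rfl⟩ := Finset.mem_image.1 hn
    rw [Finset.mem_Icc]
    exact ⟨Int.ceil_le.2 (h i hi).1, Int.le_floor.2 (h i hi).2⟩
  have h1 := Finset.card_le_card hsub
  rw [Int.card_Icc] at h1
  have h2 : ((⌊x + l⌋ + 1 - ⌈x⌉).toNat : ℝ) ≤ l + 1 := by
    have h3 : (⌊x+l⌋ : ℝ) ≤ x + l := Int.floor_le _
    have h4 : x ≤ (⌈x⌉ : ℝ) := Int.le_ceil _
    rcases le_total 0 (⌊x + l⌋ + 1 - ⌈x⌉) with h5 | h5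
    · have : (((⌊x + l⌋ + 1 - ⌈x⌉).toNat : ℤ) : ℝ) = ((⌊x + l⌋ + 1 - ⌈x⌉ : ℤ) : ℝ) := by
        rw [Int.toNat_of_nonneg h5]
      rw [← Int.cast_natCast, this]; push_cast; linarith
    · rw [Int.toNat_of_nonpos h5]; simp; linarith
  exact (Nat.cast_le.2 h1).trans h2

lemma sum_int_le (S : Finset ℤ) (n0 : ℤ) (R : ℕ) (h : ∀ n ∈ S, (n - n0).natAbs ≤ R) :
    ∑ n ∈ S, (1 : ℝ) / ((n - n0).natAbs + 1) ≤ 2 * (1 + Real.log (R + 1)) := by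
  rw [← Finset.sum_fiberwise_of_maps_to (g := fun n => (n - n0).natAbs) (t := Finset.range (R+1))
    (fun n hn => Finset.mem_range.2 (Nat.lt_succ_of_le (h n hn)))]
  have : ∀ j ∈ Finset.range (R+1), ∑ n ∈ S.filter (fun n => (n - n0).natAbs = j),
      (1 : ℝ) / ((n - n0).natAbs + 1) ≤ 2 * (1 / ((j : ℝ) + 1)) := by
    intro j _
    rw [Finset.sum_congr rfl (g := fun _ => (1 : ℝ) / (j + 1)) (fun n hn => by
      rw [(Finset.mem_filter.1 hn).2]), Finset.sum_const, nsmul_eq_mul]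
    have hc : (S.filter (fun n => (n - n0).natAbs = j)).card ≤ 2 := by
      refine (Finset.card_le_card (t := {n0 + j, n0 - j}) ?_).trans Finset.card_le_two
      intro n hn
      have := (Finset.mem_filter.1 hn).2
      simp only [Finset.mem_insert, Finset.mem_singleton]
      omega
    have : ((S.filter (fun n => (n - n0).natAbs = j)).card : ℝ) ≤ 2 := by exact_mod_cast hc
    gcongr
  refine (Finset.sum_le_sum this).trans ?_
  rw [← Finset.mul_sum]
  have h1 := harmonic_le_one_add_log (R+1)
  have h2 : ((harmonic (R+1) : ℚ) : ℝ) = ∑ j ∈ Finset.range (R+1), 1 / ((j : ℝ) + 1) := by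
    simp [harmonic]
  rw [h2] at h1
  push_cast at h1
  linarith

lemma col_sum {ι : Type*} (H : Finset ι) (v1 v2 : ι → ℝ) (z1 z2 : ι → ℤ) (δ : ℝ) (hδ : 0 < δ)
    (hinj : ∀ i j, z1 i = z1 j → z2 i = z2 j → i = j)
    (h1 : ∀ i, δ * z1 i ≤ v1 i ∧ v1 i ≤ δ * z1 i + δ)
    (h2 : ∀ i, δ * z2 i ≤ v2 i ∧ v2 i ≤ δ * z2 i + δ)
    (m c0 M : ℝ) (hm : |m| ≤ 1) (hM : 0 ≤ M) (hs : ∀ i ∈ H, |v2 i - m * v1 i - c0| ≤ M * δ)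
    (n0 : ℤ) (R : ℕ) (hR : ∀ i ∈ H, (z1 i - n0).natAbs ≤ R) :
    ∑ i ∈ H, (1 : ℝ) / ((z1 i - n0).natAbs + 1) ≤ (2 * M + 4) * (2 * (1 + Real.log (R + 1))) := by
  classical
  rw [← Finset.sum_fiberwise_of_maps_to (g := z1) (t := H.image z1)
    (fun i hi => Finset.mem_image_of_mem _ hi)]
  have key : ∀ n ∈ H.image z1, ∑ i ∈ H.filter (fun i => z1 i = n), (1 : ℝ) / ((z1 i - n0).natAbs + 1)
      ≤ (2 * M + 4) * ((1 : ℝ) / ((n - n0).natAbs + 1)) := by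
    intro n _
    rw [Finset.sum_congr rfl (g := fun _ => (1 : ℝ) / ((n - n0).natAbs + 1)) (fun i hi => by
      rw [(Finset.mem_filter.1 hi).2]), Finset.sum_const, nsmul_eq_mul]
    refine mul_le_mul_of_nonneg_right ?_ (by positivity)
    have := card_int_le (H.filter (fun i => z1 i = n)) z2 ?_ (m * n + c0 / δ - M - 2) (2 * M + 3)
      (by linarith) ?_
    · linarith
    · intro i hi j hj hij
      have hi := (Finset.mem_filter.1 hi).2
      have hj := (Finset.mem_filter.1 hj).2
      exact hinj i j (hi.trans hj.symm) hij
    · intro i hi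
      obtain ⟨hiH, rfl⟩ := Finset.mem_filter.1 hi
      have a1 := h1 i
      have a2 := h2 i
      have a3 := abs_le.1 (hs i hiH)
      obtain ⟨m1, m2⟩ := abs_le.1 hm
      have b1 : |m * (v1 i - δ * z1 i)| ≤ δ := by
        rw [abs_mul]
        calc |m| * |v1 i - δ * z1 i| ≤ 1 * δ := by
              refine mul_le_mul hm ?_ (abs_nonneg _) zero_le_one
              rw [abs_le]; constructor <;> linarith
          _ = δ := one_mul _
      obtain ⟨b2, b3⟩ := abs_le.1 b1
      have e : c0 = δ * (c0 / δ) := by field_simp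
      rw [e] at a3
      constructor
      · refine le_of_mul_le_mul_left ?_ hδ
        nlinarith
      · refine le_of_mul_le_mul_left ?_ hδ
        nlinarith
  refine (Finset.sum_le_sum key).trans ?_
  rw [← Finset.mul_sum]
  refine mul_le_mul_of_nonneg_left ?_ (by linarith)
  refine sum_int_le _ _ _ fun n hn => ?_
  obtain ⟨i, hi, rfl⟩ := Finset.mem_image.1 hn
  exact hR i hi

lemma coplanar (δ ρ u1 u2 c1 c2 t1 u1' u2' c1' c2' t' t2 : ℝ) (hρ : 0 < ρ)
    (h1 : |c1 + t1 * u1| ≤ 6 * δ) (h2 : |c2 + t1 * u2| ≤ 6 * δ)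
    (h1' : |c1' + t' * u1'| ≤ 6 * δ) (h2' : |c2' + t' * u2'| ≤ 6 * δ)
    (h3 : |c1 - c1' + t2 * (u1 - u1')| ≤ 6 * δ) (h4 : |c2 - c2' + t2 * (u2 - u2')| ≤ 6 * δ)
    (ht : ρ ≤ |t2 - t1|) (hu : u1' ≠ 0) (hle : |u2'| ≤ |u1'|) :
    |u2' / u1'| ≤ 1 ∧ |u2 - u2' / u1' * u1| ≤ 36 / ρ * δ := by
  have hm : |u2' / u1'| ≤ 1 := by
    rw [abs_div]; exact div_le_one_of_le₀ hle (abs_nonneg _)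
  refine ⟨hm, ?_⟩
  set m := u2' / u1' with hmdef
  have hmu : u2' = m * u1' := by rw [hmdef]; field_simp
  have e1 : |(t2 - t1) * u1 - (t2 - t') * u1'| ≤ 18 * δ := by
    rw [abs_le] at *
    constructor <;> linarith
  have e2 : |(t2 - t1) * u2 - (t2 - t') * u2'| ≤ 18 * δ := by
    rw [abs_le] at *
    constructor <;> linarith
  have e3 : (t2 - t1) * (u2 - m * u1) =
      ((t2 - t1) * u2 - (t2 - t') * u2') - m * ((t2 - t1) * u1 - (t2 - t') * u1') := by
    rw [hmu]; ring
  have hδ : 0 ≤ δ := by have := abs_nonneg (c1 + t1 * u1); linarith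
  have e4 : |t2 - t1| * |u2 - m * u1| ≤ 36 * δ := by
    rw [← abs_mul, e3]
    refine (abs_sub _ _).trans ?_
    rw [abs_mul m]
    have : |m| * |(t2 - t1) * u1 - (t2 - t') * u1'| ≤ 1 * (18 * δ) :=
      mul_le_mul hm e1 (abs_nonneg _) zero_le_one
    linarith
  have e5 : ρ * |u2 - m * u1| ≤ 36 * δ := by
    refine le_trans ?_ e4
    exact mul_le_mul_of_nonneg_right ht (abs_nonneg _)
  have e6 : 36 / ρ * δ = 36 * δ / ρ := by ring
  rw [e6, le_div_iff₀ hρ]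
  linarith

lemma half {ι : Type*} [Fintype ι] (f v1 v2 : ι → ℝ) (z1 z2 : ι → ℤ) (δ ρ : ℝ) (hδ : 0 < δ)
    (hδ1 : δ ≤ 1) (hρ : 0 < ρ) (hρ4 : ρ ≤ 4)
    (hinj : ∀ i j, z1 i = z1 j → z2 i = z2 j → i = j)
    (h1 : ∀ i, δ * z1 i ≤ v1 i ∧ v1 i ≤ δ * z1 i + δ)
    (h2 : ∀ i, δ * z2 i ≤ v2 i ∧ v2 i ≤ δ * z2 i + δ)
    (hb : ∀ i, |v1 i| ≤ 2) (i0 : ι) (m c0 : ℝ) (hm : |m| ≤ 1)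
    (hf0 : ∀ i, 0 ≤ f i)
    (hf1 : ∀ i, f i ≤ 144 * δ ^ 2) (hf2 : ∀ i, v1 i ≠ v1 i0 → f i ≤ 432 * δ ^ 3 / |v1 i - v1 i0|)
    (hf3 : ∀ i, f i ≠ 0 → |v2 i - m * v1 i - c0| ≤ 36 / ρ * δ) :
    ∑ i, f i ≤ 228096 * δ ^ 2 / ρ * (1 + Real.log (6 / δ)) := by
  classical
  set R : ℕ := ⌊5 / δ⌋₊ with hR
  have hz : ∀ i, (((z1 i - z1 i0).natAbs : ℕ) : ℝ) * δ ≤ |v1 i - v1 i0| + δ := by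
    intro i
    have a := h1 i
    have b := h1 i0
    rw [Nat.cast_natAbs, Int.cast_abs, ← abs_of_pos hδ, ← abs_mul, abs_of_pos hδ]
    push_cast
    have e : ((z1 i : ℝ) - z1 i0) * δ = (v1 i - v1 i0) + (((z1 i : ℝ) * δ - v1 i) - (z1 i0 * δ - v1 i0)) := by ring
    rw [e]
    refine (abs_add_le _ _).trans ?_
    gcongr
    rw [abs_le]; constructor <;> linarith
  have hR1 : ∀ i, (z1 i - z1 i0).natAbs ≤ R := by
    intro i
    rw [hR, Nat.le_floor_iff (by positivity), le_div_iff₀ hδ]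
    refine (hz i).trans ?_
    have := abs_sub (v1 i) (v1 i0)
    linarith [hb i, hb i0]
  have hf4 : ∀ i, f i ≤ 1296 * δ ^ 2 * (1 / (((z1 i - z1 i0).natAbs : ℝ) + 1)) := by
    intro i
    set j := (z1 i - z1 i0).natAbs with hj
    rw [mul_one_div, le_div_iff₀ (by positivity)]
    by_cases hj2 : j ≤ 2
    · have : (j : ℝ) ≤ 2 := by exact_mod_cast hj2
      nlinarith [hf1 i, hf0 i, sq_nonneg δ]
    · have hj3 : (3 : ℝ) ≤ j := by exact_mod_cast (by omega : 3 ≤ j)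
      have hzz := hz i
      rw [← hj] at hzz
      have hpos : ((j : ℝ) - 1) * δ ≤ |v1 i - v1 i0| := by linarith
      have hp0 : 0 < ((j : ℝ) - 1) * δ := by apply mul_pos _ hδ; linarith
      have hne : v1 i ≠ v1 i0 := by
        intro h; rw [h] at hpos; simp at hpos; linarith
      have h3 : f i ≤ 432 * δ ^ 3 / (((j : ℝ) - 1) * δ) := by
        refine (hf2 i hne).trans ?_
        gcongr
      rw [le_div_iff₀ hp0] at h3
      have h4 : f i * (j - 1) ≤ 432 * δ ^ 2 := by
        refine le_of_mul_le_mul_right ?_ hδ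
        nlinarith
      nlinarith [hf0 i]
  set H := Finset.univ.filter fun i => f i ≠ 0 with hH
  have hc := col_sum H v1 v2 z1 z2 δ hδ hinj h1 h2 m c0 (36 / ρ) hm (by positivity)
    (fun i hi => hf3 i (Finset.mem_filter.1 hi).2) (z1 i0) R (fun i _ => hR1 i)
  have hs : ∑ i, f i = ∑ i ∈ H, f i := by
    rw [hH, Finset.sum_filter_ne_zero]
  have hl : Real.log (R + 1) ≤ Real.log (6 / δ) := by
    apply Real.log_le_log (by positivity)
    have h5 : (R : ℝ) ≤ 5 / δ := Nat.floor_le (by positivity)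
    have h6 : 1 ≤ 1 / δ := by rw [le_div_iff₀ hδ]; linarith
    calc (R : ℝ) + 1 ≤ 5 / δ + 1 / δ := by linarith
      _ = 6 / δ := by ring
  have hl0 : 0 ≤ Real.log ((R:ℝ) + 1) := Real.log_nonneg (by linarith [Nat.cast_nonneg (α := ℝ) R])
  have hM : 2 * (36 / ρ) + 4 ≤ 88 / ρ := by
    have : 4 ≤ 16 / ρ := by rw [le_div_iff₀ hρ]; linarith
    calc 2 * (36 / ρ) + 4 ≤ 2 * (36 / ρ) + 16 / ρ := by linarith
      _ = _ := by ring
  calc ∑ i, f i = ∑ i ∈ H, f i := hs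
    _ ≤ ∑ i ∈ H, 1296 * δ ^ 2 * (1 / (((z1 i - z1 i0).natAbs : ℝ) + 1)) :=
        Finset.sum_le_sum fun i _ => hf4 i
    _ ≤ 1296 * δ ^ 2 * ((2 * (36 / ρ) + 4) * (2 * (1 + Real.log (R + 1)))) := by
        rw [← Finset.mul_sum]
        exact mul_le_mul_of_nonneg_left hc (by positivity)
    _ ≤ 1296 * δ ^ 2 * (88 / ρ * (2 * (1 + Real.log (6 / δ)))) := by
        gcongr
    _ = _ := by ring

/-- The hairbrush estimate. -/
lemma hairbrush {ι : Type*} [Fintype ι] (μ : Measure (ℝ × ℝ × ℝ)) [IsFiniteMeasure μ]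
    (hμ : μ ≤ volume) (δ ρ : ℝ) (hδ : 0 < δ) (hδ1 : δ ≤ 1) (hρ : 0 < ρ) (hρ4 : ρ ≤ 4)
    (t0 v1 b1 v2 b2 : ι → ℝ) (z1 z2 : ι → ℤ)
    (hinj : ∀ i j, z1 i = z1 j → z2 i = z2 j → i = j)
    (h1 : ∀ i, δ * z1 i ≤ v1 i ∧ v1 i ≤ δ * z1 i + δ)
    (h2 : ∀ i, δ * z2 i ≤ v2 i ∧ v2 i ≤ δ * z2 i + δ)
    (hb1 : ∀ i, |v1 i| ≤ 2) (hb2 : ∀ i, |v2 i| ≤ 2)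
    (v01 b01 v02 b02 : ℝ) (t1 : ι → ℝ)
    (hT1 : ∀ i, |b1 i - b01 + t1 i * (v1 i - v01)| ≤ 6 * δ)
    (hT2 : ∀ i, |b2 i - b02 + t1 i * (v2 i - v02)| ≤ 6 * δ)
    (hne : ∀ i, v1 i ≠ v01 ∨ v2 i ≠ v02)
    (Z : ι → Set (ℝ × ℝ × ℝ)) (hZm : ∀ i, MeasurableSet (Z i))
    (hZ : ∀ i, Z i ⊆ tb δ (t0 i) (v1 i) (b1 i) (v2 i) (b2 i))
    (hZρ : ∀ i, ∀ p ∈ Z i, ρ ≤ |p.1 - t1 i|)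
    (F : Set (ℝ × ℝ × ℝ)) (hF : ∀ i, Z i ⊆ F) (m : ℝ) (hm : 0 ≤ m) (hmZ : ∀ i, m ≤ μ.real (Z i)) :
    (Fintype.card ι : ℝ) * m ^ 2 ≤
      μ.real F * (228096 * δ ^ 2 / ρ * (1 + Real.log (6 / δ))) := by
  set X := 228096 * δ ^ 2 / ρ * (1 + Real.log (6 / δ)) with hX
  have key : ∀ i0, ∑ i, μ.real (Z i ∩ Z i0) ≤ X := by
    intro i0
    have hf1 : ∀ i, μ.real (Z i ∩ Z i0) ≤ 144 * δ ^ 2 := by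
      intro i
      have := vol_slab δ (t0 i) (v1 i) (b1 i) (v2 i) (b2 i) hδ.le (t0 i) 4 (Z i ∩ Z i0)
        (Set.inter_subset_left.trans (hZ i)) (fun p hp => by
          obtain ⟨a, b, _⟩ := hZ i hp.1
          exact ⟨a, b.le⟩)
      have := real_le_of_vol hμ (by positivity) this
      linarith
    have hcop : ∀ i, μ.real (Z i ∩ Z i0) ≠ 0 → ∃ p, p ∈ Z i ∧ p ∈ Z i0 := by
      intro i hi
      by_contra hcon
      push Not at hcon
      have : Z i ∩ Z i0 = ∅ := by
        ext p; simp only [Set.mem_inter_iff, Set.mem_empty_iff_false, iff_false, not_and]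
        exact hcon p
      rw [this] at hi; simp at hi
    by_cases hle : |v2 i0 - v02| ≤ |v1 i0 - v01|
    · have hu : v1 i0 - v01 ≠ 0 := by
        intro h0
        rw [h0] at hle; simp only [abs_zero, abs_nonpos_iff] at hle
        rcases hne i0 with h | h
        · exact h (sub_eq_zero.1 h0)
        · exact h (sub_eq_zero.1 hle)
      refine half (fun i => μ.real (Z i ∩ Z i0)) v1 v2 z1 z2 δ ρ hδ hδ1 hρ hρ4 hinj h1 h2 hb1 i0
        ((v2 i0 - v02) / (v1 i0 - v01)) (v02 - (v2 i0 - v02) / (v1 i0 - v01) * v01) ?_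
        (fun i => measureReal_nonneg) hf1 ?_ ?_
      · rw [abs_div]; exact div_le_one_of_le₀ hle (abs_nonneg _)
      · intro i hi
        exact real_le_of_vol hμ (by positivity) (vol_inter1 δ (t0 i) (v1 i) (b1 i) (v2 i) (b2 i)
          (t0 i0) (v1 i0) (b1 i0) (v2 i0) (b2 i0) hδ.le hi _
          (Set.inter_subset_left.trans (hZ i)) (Set.inter_subset_right.trans (hZ i0)))
      · intro i hi
        obtain ⟨p, hp, hp0⟩ := hcop i hi
        obtain ⟨q1, q2⟩ := tb_inter (hZ i hp) (hZ i0 hp0)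
        have := (coplanar δ ρ (v1 i - v01) (v2 i - v02) (b1 i - b01) (b2 i - b02) (t1 i)
          (v1 i0 - v01) (v2 i0 - v02) (b1 i0 - b01) (b2 i0 - b02) (t1 i0) p.1 hρ (hT1 i) (hT2 i)
          (hT1 i0) (hT2 i0) (by convert q1 using 2; ring) (by convert q2 using 2; ring)
          (hZρ i p hp) hu hle).2
        convert this using 2; ring
    · have hle := (not_le.1 hle).le
      have hu : v2 i0 - v02 ≠ 0 := by
        intro h0
        rw [h0] at hle; simp only [abs_zero, abs_nonpos_iff] at hle
        rcases hne i0 with h | h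
        · exact h (sub_eq_zero.1 hle)
        · exact h (sub_eq_zero.1 h0)
      refine half (fun i => μ.real (Z i ∩ Z i0)) v2 v1 z2 z1 δ ρ hδ hδ1 hρ hρ4
        (fun i j a b => hinj i j b a) h2 h1 hb2 i0
        ((v1 i0 - v01) / (v2 i0 - v02)) (v01 - (v1 i0 - v01) / (v2 i0 - v02) * v02) ?_
        (fun i => measureReal_nonneg) hf1 ?_ ?_
      · rw [abs_div]; exact div_le_one_of_le₀ hle (abs_nonneg _)
      · intro i hi
        exact real_le_of_vol hμ (by positivity) (vol_inter2 δ (t0 i) (v1 i) (b1 i) (v2 i) (b2 i)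
          (t0 i0) (v1 i0) (b1 i0) (v2 i0) (b2 i0) hδ.le hi _
          (Set.inter_subset_left.trans (hZ i)) (Set.inter_subset_right.trans (hZ i0)))
      · intro i hi
        obtain ⟨p, hp, hp0⟩ := hcop i hi
        obtain ⟨q1, q2⟩ := tb_inter (hZ i hp) (hZ i0 hp0)
        have := (coplanar δ ρ (v2 i - v02) (v1 i - v01) (b2 i - b02) (b1 i - b01) (t1 i)
          (v2 i0 - v02) (v1 i0 - v01) (b2 i0 - b02) (b1 i0 - b01) (t1 i0) p.1 hρ (hT2 i) (hT1 i)
          (hT2 i0) (hT1 i0) (by convert q2 using 2; ring) (by convert q1 using 2; ring)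
          (hZρ i p hp) hu hle).2
        convert this using 2; ring
  have hcs := cs_sets hZm μ F hF
  have hsum : ∑ i, ∑ j, μ.real (Z i ∩ Z j) ≤ Fintype.card ι * X := by
    rw [Finset.sum_comm]
    refine (Finset.sum_le_sum fun i _ => key i).trans ?_
    simp
  have hlow : (Fintype.card ι : ℝ) * m ≤ ∑ i, μ.real (Z i) := by
    have := Finset.sum_le_sum fun i (_ : i ∈ Finset.univ) => hmZ i
    simpa using this
  rcases isEmpty_or_nonempty ι with he | he
  · have hX0 : 0 ≤ X := by
      have : 0 ≤ Real.log (6 / δ) := Real.log_nonneg (by rw [le_div_iff₀ hδ]; linarith)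
      positivity
    have : (Fintype.card ι : ℝ) = 0 := by simp
    rw [this, zero_mul]
    exact mul_nonneg measureReal_nonneg hX0
  · have hc : (0 : ℝ) < Fintype.card ι := by exact_mod_cast Fintype.card_pos
    have h5 : ((Fintype.card ι : ℝ) * m) ^ 2 ≤ μ.real F * (Fintype.card ι * X) :=
      (pow_le_pow_left₀ (by positivity) hlow 2).trans
        (hcs.trans (mul_le_mul_of_nonneg_left hsum measureReal_nonneg))
    refine le_of_mul_le_mul_left ?_ hc
    nlinarith

/-! ### dyadic cells -/

def dc (k : ℕ) (x : ℝ) : ℤ := ⌊2 ^ k * (x / 4)⌋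

lemma dc_zero {x : ℝ} (h0 : 0 ≤ x) (h4 : x < 4) : dc 0 x = 0 := by
  rw [dc, Int.floor_eq_zero_iff]; constructor <;> simp <;> linarith

lemma dc_close {k : ℕ} {x y : ℝ} (h : dc k x = dc k y) : |x - y| ≤ 4 / 2 ^ k := by
  have h1 := Int.abs_sub_lt_one_of_floor_eq_floor h
  have h2 : (2:ℝ) ^ k * (x / 4) - 2 ^ k * (y / 4) = 2 ^ k / 4 * (x - y) := by ring
  rw [h2, abs_mul, abs_of_pos (by positivity)] at h1
  rw [le_div_iff₀ (by positivity)]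
  nlinarith

lemma dc_near {k : ℕ} {x y : ℝ} (h : |x - y| < 4 / 2 ^ k) :
    dc k x ∈ Finset.Icc (dc k y - 1) (dc k y + 1) := by
  rw [lt_div_iff₀ (by positivity)] at h
  have h3 : |(2:ℝ) ^ k * (x / 4) - 2 ^ k * (y / 4)| < 1 := by
    have h2 : (2:ℝ) ^ k * (x / 4) - 2 ^ k * (y / 4) = 2 ^ k / 4 * (x - y) := by ring
    rw [h2, abs_mul, abs_of_pos (by positivity)]
    linarith
  obtain ⟨h4, h5⟩ := abs_lt.1 h3
  rw [Finset.mem_Icc, dc, dc]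
  have a1 := Int.floor_le ((2:ℝ) ^ k * (x / 4))
  have a2 := Int.lt_floor_add_one ((2:ℝ) ^ k * (x / 4))
  have b1 := Int.floor_le ((2:ℝ) ^ k * (y / 4))
  have b2 := Int.lt_floor_add_one ((2:ℝ) ^ k * (y / 4))
  constructor
  · have : ((⌊(2:ℝ) ^ k * (y / 4)⌋ - 1 : ℤ) : ℝ) < ⌊(2:ℝ) ^ k * (x / 4)⌋ + 1 := by push_cast; linarith
    have : (⌊(2:ℝ) ^ k * (y / 4)⌋ - 1 : ℤ) < ⌊(2:ℝ) ^ k * (x / 4)⌋ + 1 := by exact_mod_cast this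
    omega
  · have : ((⌊(2:ℝ) ^ k * (x / 4)⌋ : ℤ) : ℝ) < ⌊(2:ℝ) ^ k * (y / 4)⌋ + 1 + 1 := by linarith
    have : (⌊(2:ℝ) ^ k * (x / 4)⌋ : ℤ) < ⌊(2:ℝ) ^ k * (y / 4)⌋ + 1 + 1 := by exact_mod_cast this
    omega

lemma dc_measurable (k : ℕ) (t0 : ℝ) (n : ℤ) :
    MeasurableSet {p : ℝ × ℝ × ℝ | dc k (p.1 - t0) = n} := by
  have : Measurable fun p : ℝ × ℝ × ℝ => dc k (p.1 - t0) := by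
    unfold dc; fun_prop
  exact this (measurableSet_singleton n)

lemma dc_range {k : ℕ} {x : ℝ} (h0 : 0 ≤ x) (h4 : x < 4) : 0 ≤ dc k x ∧ dc k x ≤ 2 ^ k := by
  unfold dc
  constructor
  · exact Int.floor_nonneg.2 (by positivity)
  · have : (2:ℝ) ^ k * (x / 4) ≤ ((2 ^ k : ℤ) : ℝ) := by
      push_cast
      have : (0:ℝ) < 2 ^ k := by positivity
      nlinarith
    have := Int.floor_mono this
    rwa [Int.floor_intCast] at this

/-- The two-ends reduction for a single tube. -/
lemma two_ends (μ : Measure (ℝ × ℝ × ℝ)) [IsFiniteMeasure μ] (Y : Set (ℝ × ℝ × ℝ)) (t0 : ℝ)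
    (hYt : ∀ p ∈ Y, t0 ≤ p.1 ∧ p.1 < t0 + 4) (J : ℕ) (β : ℝ) (hβ : 1 ≤ β) :
    ∃ j n, j ≤ J ∧ μ.real Y ≤ β ^ J * μ.real (Y ∩ {p | dc j (p.1 - t0) = n}) ∧
      ∀ i ≤ J, ∀ ts : ℝ, β ^ i * μ.real (Y ∩ {p | |p.1 - ts| < 4 / 2 ^ i}) ≤
        3 * (β ^ j * μ.real (Y ∩ {p | dc j (p.1 - t0) = n})) := by
  obtain ⟨⟨j, n⟩, hm, hmax⟩ := Finset.exists_max_image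
    (Finset.range (J+1) ×ˢ Finset.Icc (0:ℤ) (2 ^ J))
    (fun q : ℕ × ℤ => β ^ q.1 * μ.real (Y ∩ {p | dc q.1 (p.1 - t0) = q.2}))
    ⟨(0, 0), by simp⟩
  simp only [Finset.mem_product, Finset.mem_range, Finset.mem_Icc] at hm hmax
  have hβ0 : 0 < β := by linarith
  have hmax' : ∀ i ≤ J, ∀ n', β ^ i * μ.real (Y ∩ {p | dc i (p.1 - t0) = n'}) ≤
      β ^ j * μ.real (Y ∩ {p | dc j (p.1 - t0) = n}) := by
    intro i hi n'
    by_cases hn : 0 ≤ n' ∧ n' ≤ 2 ^ J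
    · exact hmax (i, n') ⟨by simp; omega, hn⟩
    · have : Y ∩ {p | dc i (p.1 - t0) = n'} = ∅ := by
        ext p
        simp only [Set.mem_inter_iff, Set.mem_ofPred_eq, Set.mem_empty_iff_false, iff_false, not_and]
        rintro hp rfl
        obtain ⟨h1, h2⟩ := hYt p hp
        obtain ⟨h3, h4⟩ := dc_range (k := i) (x := p.1 - t0) (by linarith) (by linarith)
        refine hn ⟨h3, h4.trans ?_⟩
        exact pow_le_pow_right₀ (by norm_num) hi
      rw [this]; simp; positivity
  refine ⟨j, n, by omega, ?_, ?_⟩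
  · have h0 := hmax' 0 (by omega) 0
    have : Y ∩ {p | dc 0 (p.1 - t0) = 0} = Y := by
      refine Set.inter_eq_left.2 fun p hp => ?_
      obtain ⟨h1, h2⟩ := hYt p hp
      exact dc_zero (by linarith) (by linarith)
    rw [this, pow_zero, one_mul] at h0
    refine h0.trans ?_
    gcongr
    omega
  · intro i hi ts
    set n0 := dc i (ts - t0) with hn0
    have hsub : Y ∩ {p | |p.1 - ts| < 4 / 2 ^ i} ⊆
        ⋃ n' ∈ Finset.Icc (n0 - 1) (n0 + 1), Y ∩ {p | dc i (p.1 - t0) = n'} := by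
      rintro p ⟨hp, hp2⟩
      simp only [Set.mem_iUnion]
      refine ⟨dc i (p.1 - t0), dc_near ?_, hp, rfl⟩
      have e : p.1 - t0 - (ts - t0) = p.1 - ts := by ring
      rw [e]; exact hp2
    have h1 : μ.real (Y ∩ {p | |p.1 - ts| < 4 / 2 ^ i}) ≤
        ∑ n' ∈ Finset.Icc (n0 - 1) (n0 + 1), μ.real (Y ∩ {p | dc i (p.1 - t0) = n'}) :=
      (measureReal_mono hsub (measure_ne_top _ _)).trans (measureReal_biUnion_finset_le _ _)
    calc β ^ i * μ.real (Y ∩ {p | |p.1 - ts| < 4 / 2 ^ i})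
        ≤ ∑ n' ∈ Finset.Icc (n0 - 1) (n0 + 1), β ^ i * μ.real (Y ∩ {p | dc i (p.1 - t0) = n'}) := by
          rw [← Finset.mul_sum]; gcongr
      _ ≤ ∑ n' ∈ Finset.Icc (n0 - 1) (n0 + 1), β ^ j * μ.real (Y ∩ {p | dc j (p.1 - t0) = n}) :=
          Finset.sum_le_sum fun n' _ => hmax' i hi n'
      _ = _ := by
          rw [Finset.sum_const, Int.card_Icc, nsmul_eq_mul]
          congr 1
          have : (n0 + 1 + 1 - (n0 - 1)).toNat = 3 := by omega
          rw [this]; norm_num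

lemma hair_sum {ι : Type*} (μ : Measure (ℝ × ℝ × ℝ)) [IsFiniteMeasure μ]
    (hμ : μ ≤ volume) (δ ρ : ℝ) (hδ : 0 < δ) (hδ1 : δ ≤ 1) (hρ : 0 < ρ) (hρ4 : ρ ≤ 4)
    (t0 v1 b1 v2 b2 : ι → ℝ) (z1 z2 : ι → ℤ)
    (hinj : ∀ i j, z1 i = z1 j → z2 i = z2 j → i = j)
    (h1 : ∀ i, δ * z1 i ≤ v1 i ∧ v1 i ≤ δ * z1 i + δ)
    (h2 : ∀ i, δ * z2 i ≤ v2 i ∧ v2 i ≤ δ * z2 i + δ)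
    (hb1 : ∀ i, |v1 i| ≤ 2) (hb2 : ∀ i, |v2 i| ≤ 2)
    (Y : ι → Set (ℝ × ℝ × ℝ)) (hYm : ∀ i, MeasurableSet (Y i))
    (hY : ∀ i, Y i ⊆ tb δ (t0 i) (v1 i) (b1 i) (v2 i) (b2 i))
    (F : Set (ℝ × ℝ × ℝ)) (hF : ∀ i, Y i ⊆ F) (m : ℝ) (hm : 0 ≤ m)
    (G : Finset ι) (hmY : ∀ i ∈ G, ∀ ts : ℝ, m ≤ μ.real (Y i ∩ {p | ρ ≤ |p.1 - ts|}))
    (s : ℝ) (hs : 0 < s) (i0 : ι) (hfar : ∀ i ∈ G, s ≤ |v1 i - v1 i0| ∨ s ≤ |v2 i - v2 i0|) :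
    (∑ i ∈ G, μ.real (Y i ∩ Y i0)) * m ^ 2 ≤
      432 * δ ^ 3 / s * (μ.real F * (228096 * δ ^ 2 / ρ * (1 + Real.log (6 / δ)))) := by
  classical
  set H := G.filter fun i => (Y i ∩ Y i0).Nonempty with hH
  have hsum : ∑ i ∈ G, μ.real (Y i ∩ Y i0) = ∑ i ∈ H, μ.real (Y i ∩ Y i0) := by
    symm
    refine Finset.sum_subset (Finset.filter_subset _ _) fun i hi hn => ?_
    have : Y i ∩ Y i0 = ∅ := by
      by_contra hcon
      exact hn (Finset.mem_filter.2 ⟨hi, Set.nonempty_iff_ne_empty.2 hcon⟩)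
    rw [this]; simp
  have hterm : ∀ i ∈ H, μ.real (Y i ∩ Y i0) ≤ 432 * δ ^ 3 / s := by
    intro i hi
    have hiG := (Finset.mem_filter.1 hi).1
    rcases hfar i hiG with h | h
    · have hne : v1 i ≠ v1 i0 := by intro h'; rw [h'] at h; simp at h; linarith
      refine (real_le_of_vol hμ (by positivity) (vol_inter1 δ (t0 i) (v1 i) (b1 i) (v2 i) (b2 i)
          (t0 i0) (v1 i0) (b1 i0) (v2 i0) (b2 i0) hδ.le hne _
          (Set.inter_subset_left.trans (hY i)) (Set.inter_subset_right.trans (hY i0)))).trans ?_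
      gcongr
    · have hne : v2 i ≠ v2 i0 := by intro h'; rw [h'] at h; simp at h; linarith
      refine (real_le_of_vol hμ (by positivity) (vol_inter2 δ (t0 i) (v1 i) (b1 i) (v2 i) (b2 i)
          (t0 i0) (v1 i0) (b1 i0) (v2 i0) (b2 i0) hδ.le hne _
          (Set.inter_subset_left.trans (hY i)) (Set.inter_subset_right.trans (hY i0)))).trans ?_
      gcongr
  have hpt : ∀ i : {i // i ∈ H}, ∃ p, p ∈ Y i ∧ p ∈ Y i0 := fun i => (Finset.mem_filter.1 i.2).2
  choose P hP1 hP2 using hpt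
  have hh := hairbrush (ι := {i // i ∈ H}) μ hμ δ ρ hδ hδ1 hρ hρ4 (fun i => t0 i) (fun i => v1 i)
    (fun i => b1 i) (fun i => v2 i) (fun i => b2 i) (fun i => z1 i) (fun i => z2 i)
    (fun i j a b => Subtype.ext (hinj i j a b)) (fun i => h1 i) (fun i => h2 i) (fun i => hb1 i)
    (fun i => hb2 i) (v1 i0) (b1 i0) (v2 i0) (b2 i0) (fun i => (P i).1)
    (fun i => (tb_inter (hY _ (hP1 i)) (hY _ (hP2 i))).1)
    (fun i => (tb_inter (hY _ (hP1 i)) (hY _ (hP2 i))).2)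
    (fun i => by
      rcases hfar i (Finset.mem_filter.1 i.2).1 with h | h
      · left; intro h'; rw [h'] at h; simp at h; linarith
      · right; intro h'; rw [h'] at h; simp at h; linarith)
    (fun i => Y i ∩ {p | ρ ≤ |p.1 - (P i).1|})
    (fun i => (hYm i).inter (measurableSet_le (by fun_prop) (by fun_prop)))
    (fun i => Set.inter_subset_left.trans (hY i)) (fun i p hp => hp.2) F
    (fun i => Set.inter_subset_left.trans (hF i)) m hm
    (fun i => hmY i (Finset.mem_filter.1 i.2).1 _)
  rw [Fintype.card_coe] at hh
  have h5 : ∑ i ∈ H, μ.real (Y i ∩ Y i0) ≤ H.card * (432 * δ ^ 3 / s) := by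
    refine (Finset.sum_le_sum hterm).trans ?_
    simp
  rw [hsum]
  calc (∑ i ∈ H, μ.real (Y i ∩ Y i0)) * m ^ 2 ≤ (H.card * (432 * δ ^ 3 / s)) * m ^ 2 := by gcongr
    _ = 432 * δ ^ 3 / s * (H.card * m ^ 2) := by ring
    _ ≤ _ := by gcongr

section core
open Classical

lemma pair_card {ι : Type*} (H : Finset ι) (z1 z2 : ι → ℤ)
    (hinj : ∀ i j, z1 i = z1 j → z2 i = z2 j → i = j) (x1 x2 l : ℝ) (hl : 0 ≤ l)
    (h1 : ∀ i ∈ H, x1 ≤ z1 i ∧ (z1 i : ℝ) ≤ x1 + l)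
    (h2 : ∀ i ∈ H, x2 ≤ z2 i ∧ (z2 i : ℝ) ≤ x2 + l) : (H.card : ℝ) ≤ (l + 1) ^ 2 := by
  have e : H.card ≤ (H.image z1 ×ˢ H.image z2).card := by
    refine Finset.card_le_card_of_injOn (fun i => (z1 i, z2 i)) ?_ ?_
    · intro i hi
      simp only [Finset.coe_product, Set.mem_prod, Finset.mem_coe]
      exact ⟨Finset.mem_image_of_mem _ hi, Finset.mem_image_of_mem _ hi⟩
    · intro i _ j _ hij
      simp only [Prod.mk.injEq] at hij
      exact hinj i j hij.1 hij.2
  rw [Finset.card_product] at e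
  have c1 : ((H.image z1).card : ℝ) ≤ l + 1 := by
    refine card_int_le _ (fun x : ℤ => x) (fun a _ b _ h => h) x1 l hl ?_
    intro n hn
    obtain ⟨i, hi, rfl⟩ := Finset.mem_image.1 hn
    exact h1 i hi
  have c2 : ((H.image z2).card : ℝ) ≤ l + 1 := by
    refine card_int_le _ (fun x : ℤ => x) (fun a _ b _ h => h) x2 l hl ?_
    intro n hn
    obtain ⟨i, hi, rfl⟩ := Finset.mem_image.1 hn
    exact h2 i hi
  calc (H.card : ℝ) ≤ ((H.image z1).card : ℝ) * ((H.image z2).card : ℝ) := by exact_mod_cast e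
    _ ≤ (l+1) * (l+1) := by gcongr
    _ = _ := by ring

lemma dc_bounds {k : ℕ} {x : ℝ} {g : ℤ} (h : dc k x = g) :
    (g : ℝ) * (4 / 2 ^ k) ≤ x ∧ x ≤ (g : ℝ) * (4 / 2 ^ k) + 4 / 2 ^ k := by
  unfold dc at h
  have h1 := Int.floor_le ((2:ℝ) ^ k * (x / 4))
  have h2 := Int.lt_floor_add_one ((2:ℝ) ^ k * (x / 4))
  rw [h] at h1 h2
  have hp : (0:ℝ) < 2 ^ k := by positivity
  have e : x = (2:ℝ) ^ k * (x / 4) * (4 / 2 ^ k) := by field_simp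
  have hq : (0:ℝ) < 4 / 2 ^ k := by positivity
  constructor
  · rw [e]; gcongr
  · rw [e]
    calc (2:ℝ) ^ k * (x / 4) * (4 / 2 ^ k) ≤ (g + 1) * (4 / 2 ^ k) := by gcongr
      _ = _ := by ring

lemma cell_card {ι : Type*} (G : Finset ι) (δ : ℝ) (hδ : 0 < δ) (v1 v2 : ι → ℝ) (z1 z2 : ι → ℤ)
    (hinj : ∀ i j, z1 i = z1 j → z2 i = z2 j → i = j)
    (h1 : ∀ i, δ * z1 i ≤ v1 i ∧ v1 i ≤ δ * z1 i + δ)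
    (h2 : ∀ i, δ * z2 i ≤ v2 i ∧ v2 i ≤ δ * z2 i + δ) (l : ℕ) (g1 g2 : ℤ)
    (hG : ∀ i ∈ G, dc l (v1 i + 2) = g1 ∧ dc l (v2 i + 2) = g2) :
    (G.card : ℝ) ≤ (4 / 2 ^ l / δ + 2) ^ 2 := by
  have key : ∀ (v : ℝ) (z g : ℤ), δ * z ≤ v ∧ v ≤ δ * z + δ → dc l (v + 2) = g →
      ((g * (4 / 2 ^ l) - 2) / δ - 1 ≤ z ∧
        (z : ℝ) ≤ ((g * (4 / 2 ^ l) - 2) / δ - 1) + (4 / 2 ^ l / δ + 1)) := by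
    intro v z g hv hd
    obtain ⟨a, b⟩ := dc_bounds hd
    constructor
    · rw [sub_le_iff_le_add, div_le_iff₀ hδ]; nlinarith [hv.2]
    · have : ((g * (4 / 2 ^ l) - 2) / δ - 1) + (4 / 2 ^ l / δ + 1) =
        ((g * (4 / 2 ^ l) - 2) + 4 / 2 ^ l) / δ := by ring
      rw [this, le_div_iff₀ hδ]; nlinarith [hv.1]
  have := pair_card G z1 z2 hinj _ _ (4 / 2 ^ l / δ + 1) (by positivity)
    (fun i hi => key _ _ _ (h1 i) (hG i hi).1) (fun i hi => key _ _ _ (h2 i) (hG i hi).2)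
  refine this.trans (le_of_eq ?_); ring

lemma far_pairs {ι : Type*} (s : Finset ι) (near : ι → ι → Prop)
    (h : ∀ i ∈ s, 2 * (s.filter fun j => near j i).card ≤ s.card) :
    (s.card : ℝ) ^ 2 ≤ 2 * ∑ i ∈ s, ((s.filter fun j => ¬ near j i).card : ℝ) := by
  have h2 : ∀ i ∈ s, (s.card : ℝ) ≤ 2 * ((s.filter fun j => ¬ near j i).card : ℝ) := by
    intro i hi
    have e := Finset.card_filter_add_card_filter_not (s := s) (fun j => near j i)
    have := h i hi
    have : s.card ≤ 2 * (s.filter fun j => ¬ near j i).card := by omega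
    exact_mod_cast this
  calc (s.card : ℝ) ^ 2 = ∑ i ∈ s, (s.card : ℝ) := by simp [sq]
    _ ≤ ∑ i ∈ s, 2 * ((s.filter fun j => ¬ near j i).card : ℝ) := Finset.sum_le_sum h2
    _ = _ := by rw [Finset.mul_sum]

lemma near_card {ι : Type*} (v1 v2 : ι → ℝ) (s : Finset ι) (q : ℕ) (M : ℝ)
    (hM : ∀ γ' : ℤ × ℤ, ((s.filter fun i => (dc q (v1 i + 2), dc q (v2 i + 2)) = γ').card : ℝ) ≤ M)
    (i : ι) (t : Finset ι) (ht : t ⊆ s) :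
    ((t.filter fun j => |v1 j - v1 i| < 4 / 2 ^ q ∧ |v2 j - v2 i| < 4 / 2 ^ q).card : ℝ)
      ≤ 9 * M := by
  set n1 := dc q (v1 i + 2)
  set n2 := dc q (v2 i + 2)
  have hsub : (t.filter fun j => |v1 j - v1 i| < 4 / 2 ^ q ∧ |v2 j - v2 i| < 4 / 2 ^ q) ⊆
      (Finset.Icc (n1-1) (n1+1) ×ˢ Finset.Icc (n2-1) (n2+1)).biUnion
        fun γ' => s.filter fun i => (dc q (v1 i + 2), dc q (v2 i + 2)) = γ' := by
    intro j hj
    obtain ⟨hjt, h1, h2⟩ := Finset.mem_filter.1 hj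
    refine Finset.mem_biUnion.2 ⟨(dc q (v1 j + 2), dc q (v2 j + 2)), ?_,
      Finset.mem_filter.2 ⟨ht hjt, rfl⟩⟩
    refine Finset.mem_product.2 ⟨dc_near ?_, dc_near ?_⟩
    · have : v1 j + 2 - (v1 i + 2) = v1 j - v1 i := by ring
      rw [this]; exact h1
    · have : v2 j + 2 - (v2 i + 2) = v2 j - v2 i := by ring
      rw [this]; exact h2
  have h3 := (Finset.card_le_card hsub).trans Finset.card_biUnion_le
  calc _ ≤ ((∑ γ' ∈ (Finset.Icc (n1-1) (n1+1) ×ˢ Finset.Icc (n2-1) (n2+1)),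
      (s.filter fun i => (dc q (v1 i + 2), dc q (v2 i + 2)) = γ').card : ℕ) : ℝ) := by
        exact_mod_cast h3
    _ ≤ ∑ γ' ∈ (Finset.Icc (n1-1) (n1+1) ×ˢ Finset.Icc (n2-1) (n2+1)), M := by
        push_cast
        exact Finset.sum_le_sum fun γ' _ => hM γ'
    _ = 9 * M := by
        rw [Finset.sum_const, Finset.card_product, Int.card_Icc, Int.card_Icc, nsmul_eq_mul]
        have a1 : (n1 + 1 + 1 - (n1 - 1)).toNat = 3 := by omega
        have a2 : (n2 + 1 + 1 - (n2 - 1)).toNat = 3 := by omega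
        rw [a1, a2]; norm_num

set_option maxHeartbeats 4000000 in
theorem core_disc {ι : Type*} [Fintype ι] (μ : Measure (ℝ × ℝ × ℝ)) [IsFiniteMeasure μ]
    (hμ : μ ≤ volume) (δ ρ : ℝ) (hδ : 0 < δ) (hδ1 : δ ≤ 1) (hρ : 0 < ρ) (hρ4 : ρ ≤ 4)
    (t0 v1 b1 v2 b2 : ι → ℝ) (z1 z2 : ι → ℤ)
    (hinj : ∀ i j, z1 i = z1 j → z2 i = z2 j → i = j)
    (h1 : ∀ i, δ * z1 i ≤ v1 i ∧ v1 i ≤ δ * z1 i + δ)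
    (h2 : ∀ i, δ * z2 i ≤ v2 i ∧ v2 i ≤ δ * z2 i + δ)
    (hb1 : ∀ i, -2 ≤ v1 i ∧ v1 i < 2) (hb2 : ∀ i, -2 ≤ v2 i ∧ v2 i < 2)
    (Y : ι → Set (ℝ × ℝ × ℝ)) (hYm : ∀ i, MeasurableSet (Y i))
    (hY : ∀ i, Y i ⊆ tb δ (t0 i) (v1 i) (b1 i) (v2 i) (b2 i))
    (τ ρ0 : ℝ) (hτ0 : 0 < τ) (hρ0 : 0 < ρ0)
    (hte : ∀ i, ∀ ts : ℝ, μ.real (Y i ∩ {p | |p.1 - ts| < ρ}) ≤ τ / 2 * μ.real (Y i))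
    (hY0 : ∀ i, ρ0 ≤ μ.real (Y i))
    (K h : ℕ) (hK1 : 1 ≤ δ * 2 ^ K) (hK2 : δ * 2 ^ K ≤ 2) (β : ℝ) (hβ : 1 ≤ β)
    (hh : 72 ≤ β ^ h) (hτ : 2 * (K + 1) * τ ≤ (β ^ K)⁻¹) :
    ((β ^ K)⁻¹ * ((Fintype.card ι : ℝ) * ρ0)) ^ 2 ≤
      16 * (6912 * 2 ^ h * Real.sqrt (Fintype.card ι) * δ ^ 4 * 228096 * (1 + Real.log (6 / δ)) /
        (τ ^ 2 * ρ0 ^ 2 * ρ) + 256 * 16 ^ h) * (μ.real Set.univ) ^ 2 := by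
  set c : ℕ → ι → ℤ × ℤ := fun k i => (dc k (v1 i + 2), dc k (v2 i + 2)) with hc
  have hc0 : ∀ i j, c 0 i = c 0 j := by
    have : ∀ i, c 0 i = (0, 0) := by
      intro i
      simp only [hc]
      rw [dc_zero (by linarith [(hb1 i).1]) (by linarith [(hb1 i).2]),
        dc_zero (by linarith [(hb2 i).1]) (by linarith [(hb2 i).2])]
    intro i j; rw [this, this]
  have hcell := fun s => exists_cell c hc0 K β hβ s
  choose k γ hkK hks hkmax using hcell
  set w : Finset ι → ℝ := fun s => μ.real {x | sig Y x = s} with hw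
  have w0 : ∀ s, 0 ≤ w s := fun s => measureReal_nonneg
  set so : Finset ι → Finset ι := fun s => s.filter fun i => c (k s) i = γ s with hso
  set y : ι → ℝ := fun i => μ.real (Y i) with hy
  set m : ι → ℕ → ℝ := fun i l => ∑ s, if i ∈ so s ∧ k s = l then w s else 0 with hm
  set sg : Finset ι → Finset ι := fun s => (so s).filter fun i => τ * y i ≤ m i (k s) with hsg
  have hyw : ∀ i, y i = ∑ s, if i ∈ s then w s else 0 := by
    intro i
    have := real_sig hYm μ (fun s => i ∈ s)
    rw [← this]
    simp only [mem_sig, hy]; rfl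
  have huniv : ∑ s, w s = μ.real Set.univ := by
    have := real_sig hYm μ (fun _ => True)
    simp only [if_true] at this
    rw [← this]; congr 1
  have βK : 0 < β ^ K := by positivity
  have hL : 0 < 1 + Real.log (6 / δ) := by
    have : 0 ≤ Real.log (6/δ) := Real.log_nonneg (by rw [le_div_iff₀ hδ]; linarith)
    linarith
  set B1 := 6912 * 2 ^ h * Real.sqrt (Fintype.card ι) * δ ^ 4 * 228096 * (1 + Real.log (6 / δ)) /
        (τ ^ 2 * ρ0 ^ 2 * ρ) with hB1
  have B10 : 0 ≤ B1 := by positivity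
  set B := B1 + 256 * 16 ^ h with hBdef
  have hB : ∀ l g, (∑ s, if k s = l ∧ γ s = g ∧ (so s).card ≤ 4 * (sg s).card then
        w s * ((sg s).card : ℝ) ^ 2 else 0) ≤ B * ∑ s, if k s = l ∧ γ s = g then w s else 0 := by
    intro l g
    have S0 : 0 ≤ ∑ s, if k s = l ∧ γ s = g then w s else 0 := by
      refine Finset.sum_nonneg fun s _ => ?_
      split_ifs; exacts [w0 s, le_rfl]
    by_cases hlK : K < l
    · refine le_trans (le_of_eq ?_) (mul_nonneg (by positivity) S0)
      refine Finset.sum_eq_zero fun s _ => ?_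
      rw [if_neg]
      rintro ⟨h', -⟩
      have := hkK s
      omega
    push Not at hlK
    set G : Finset ι := Finset.univ.filter fun i => c l i = g ∧ τ * y i ≤ m i l with hG
    have hsgG : ∀ s, k s = l → γ s = g → sg s ⊆ G := by
      intro s e1 e2 i hi
      simp only [hsg, hso, Finset.mem_filter] at hi
      rw [e1, e2] at hi
      simp only [hG, Finset.mem_filter, Finset.mem_univ, true_and]
      exact ⟨hi.1.2, hi.2⟩
    have hGc : (G.card : ℝ) ≤ (4 / 2 ^ l / δ + 2) ^ 2 := by
      refine cell_card G δ hδ v1 v2 z1 z2 hinj h1 h2 l g.1 g.2 fun i hi => ?_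
      have := (Finset.mem_filter.1 hi).2.1
      simp only [hc] at this
      exact ⟨congrArg Prod.fst this, congrArg Prod.snd this⟩
    by_cases hlh : K < l + h
    · -- the narrow case
      have e1 : (2:ℝ) / δ ≤ 2 ^ l * 2 ^ h := by
        rw [← pow_add]
        calc 2 / δ ≤ 2 * 2 ^ K := by rw [div_le_iff₀ hδ]; linarith
          _ = 2 ^ (K+1) := by ring
          _ ≤ 2 ^ (l+h) := pow_le_pow_right₀ (by norm_num) (by omega)
      have e2 : (4:ℝ) / 2 ^ l / δ + 2 ≤ 4 * 2 ^ h := by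
        have : (4:ℝ) / 2 ^ l / δ ≤ 2 * 2 ^ h := by
          rw [div_div, div_le_iff₀ (by positivity)]
          rw [div_le_iff₀ hδ] at e1
          nlinarith
        have : (1:ℝ) ≤ 2 ^ h := one_le_pow₀ (by norm_num)
        linarith
      have e3 : (G.card : ℝ) ≤ 16 * 4 ^ h := by
        refine hGc.trans ?_
        calc ((4:ℝ) / 2 ^ l / δ + 2) ^ 2 ≤ (4 * 2 ^ h) ^ 2 := by gcongr
          _ = _ := by rw [mul_pow, ← pow_mul, mul_comm h 2, pow_mul]; norm_num
      calc _ ≤ ∑ s, (256 * 16 ^ h) * (if k s = l ∧ γ s = g then w s else 0) := by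
            refine Finset.sum_le_sum fun s _ => ?_
            by_cases hs : k s = l ∧ γ s = g
            · rw [if_pos hs]
              have e4 : ((sg s).card : ℝ) ≤ 16 * 4 ^ h :=
                le_trans (by exact_mod_cast Finset.card_le_card (hsgG s hs.1 hs.2)) e3
              have e5 : ((sg s).card : ℝ)^2 ≤ 256 * 16 ^ h := by
                calc ((sg s).card : ℝ)^2 ≤ (16 * 4 ^ h)^2 := by gcongr
                  _ = _ := by rw [mul_pow, ← pow_mul, mul_comm h 2, pow_mul]; norm_num
              split_ifs
              · rw [mul_comm]; gcongr
              · have := w0 s; positivity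
            · rw [if_neg hs, if_neg (fun h' => hs ⟨h'.1, h'.2.1⟩)]; simp
        _ = (256 * 16 ^ h) * ∑ s, (if k s = l ∧ γ s = g then w s else 0) := by rw [Finset.mul_sum]
        _ ≤ _ := by gcongr; rw [hBdef]; linarith
    push Not at hlh
    -- main case
    set F : Set (ℝ × ℝ × ℝ) := {x | k (sig Y x) = l ∧ γ (sig Y x) = g} with hF
    have hFm : MeasurableSet F := meas_sig hYm (fun s => k s = l ∧ γ s = g)
    have hFr : μ.real F = ∑ s, if k s = l ∧ γ s = g then w s else 0 :=
      real_sig hYm μ (fun s => k s = l ∧ γ s = g)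
    set Yk : ι → Set (ℝ × ℝ × ℝ) := fun i => Y i ∩ F with hYk
    have hYkr : ∀ i, c l i = g → m i l ≤ μ.real (Yk i) := by
      intro i hi
      have e := real_sig hYm μ (fun s => i ∈ so s ∧ k s = l)
      simp only [hm]
      rw [← e]
      refine measureReal_mono ?_ (measure_ne_top _ _)
      rintro x ⟨hx1, hx2⟩
      simp only [hso, Finset.mem_filter, mem_sig] at hx1
      refine ⟨hx1.1, hx2, ?_⟩
      rw [← hx1.2, hx2, hi]
    set θ : ℝ := 4 / 2 ^ l with hθ
    have hθ0 : 0 < θ := by positivity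
    set sep : ℝ := 4 / 2 ^ (l + h) with hsep
    have hsep0 : 0 < sep := by positivity
    have hθδ : 2 * δ ≤ θ := by
      rw [hθ, le_div_iff₀ (by positivity)]
      have : (2:ℝ) ^ l ≤ 2 ^ K := pow_le_pow_right₀ (by norm_num) hlK
      nlinarith
    set near : ι → ι → Prop := fun j i => |v1 j - v1 i| < sep ∧ |v2 j - v2 i| < sep with hnear
    have hhair : ∀ i0, (∑ i ∈ G.filter (fun i => ¬ near i i0), μ.real (Yk i ∩ Yk i0)) *
        (τ * ρ0 / 2) ^ 2 ≤ 432 * δ ^ 3 / sep *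
          (μ.real F * (228096 * δ ^ 2 / ρ * (1 + Real.log (6 / δ)))) := by
      intro i0
      refine hair_sum μ hμ δ ρ hδ hδ1 hρ hρ4 t0 v1 b1 v2 b2 z1 z2 hinj h1 h2
        (fun i => abs_le.2 ⟨(hb1 i).1, (hb1 i).2.le⟩) (fun i => abs_le.2 ⟨(hb2 i).1, (hb2 i).2.le⟩)
        Yk (fun i => (hYm i).inter hFm) (fun i => Set.inter_subset_left.trans (hY i)) F
        (fun i => Set.inter_subset_right) (τ * ρ0 / 2) (by positivity) _ ?_ sep hsep0 i0 ?_
      · intro i hi ts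
        have hiG := (Finset.mem_filter.1 (Finset.mem_filter.1 hi).1).2
        have a1 := hYkr i hiG.1
        have a2 := hte i ts
        have a3 : μ.real (Yk i) ≤ μ.real (Yk i ∩ {p | ρ ≤ |p.1 - ts|}) +
            μ.real (Y i ∩ {p | |p.1 - ts| < ρ}) := by
          refine (measureReal_mono ?_ (measure_ne_top _ _)).trans (measureReal_union_le _ _)
          intro p hp
          by_cases hq : ρ ≤ |p.1 - ts|
          · left; exact ⟨hp, hq⟩
          · right; exact ⟨hp.1, not_le.1 hq⟩
        have a4 := hY0 i
        have a5 := hiG.2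
        simp only [hy] at a5
        nlinarith
      · intro i hi
        have := (Finset.mem_filter.1 hi).2
        simp only [hnear] at this
        by_contra hcon
        push Not at hcon
        exact this hcon
    have hGN : (G.card : ℝ) ≤ Real.sqrt (Fintype.card ι) * (2 * θ / δ) := by
      have g1 : (G.card : ℝ) ≤ Fintype.card ι := by exact_mod_cast Finset.card_le_univ G
      have g2 : (G.card : ℝ) ≤ (2 * θ / δ) ^ 2 := by
        refine hGc.trans ?_
        have : (2:ℝ) ≤ θ / δ := by rw [le_div_iff₀ hδ]; exact hθδ
        have e : 2 * θ / δ = θ / δ + θ / δ := by ring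
        rw [e]
        gcongr
      calc (G.card : ℝ) = Real.sqrt G.card * Real.sqrt G.card :=
            (Real.mul_self_sqrt (by positivity)).symm
        _ ≤ Real.sqrt (Fintype.card ι) * Real.sqrt ((2 * θ / δ) ^ 2) := by gcongr
        _ = _ := by rw [Real.sqrt_sq (by positivity)]
    set T := ∑ i0 ∈ G, ∑ i ∈ G.filter (fun i => ¬ near i i0), μ.real (Yk i ∩ Yk i0) with hT
    have hsum : (∑ s, if k s = l ∧ γ s = g ∧ (so s).card ≤ 4 * (sg s).card then
        w s * ((sg s).card : ℝ) ^ 2 else 0) ≤ 2 * T := by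
      have step : ∀ s, (if k s = l ∧ γ s = g ∧ (so s).card ≤ 4 * (sg s).card then
        w s * ((sg s).card : ℝ) ^ 2 else 0) ≤ 2 * ∑ i0 ∈ G, ∑ i ∈ G.filter (fun i => ¬ near i i0),
          if (k s = l ∧ γ s = g) ∧ i ∈ s ∧ i0 ∈ s then w s else 0 := by
        intro s
        by_cases hs : k s = l ∧ γ s = g ∧ (so s).card ≤ 4 * (sg s).card
        · rw [if_pos hs]
          have hsgs : sg s ⊆ s := (Finset.filter_subset _ _).trans (Finset.filter_subset _ _)
          have hsgG' := hsgG s hs.1 hs.2.1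
          have hfp := far_pairs (sg s) near (by
            intro i _
            have hM := near_card v1 v2 s (l + h) ((so s).card / β ^ h) (by
              intro γ'
              have a := hkmax s (l + h) hlh γ'
              rw [hs.1, pow_add] at a
              rw [le_div_iff₀ (by positivity)]
              have bl : 0 < β ^ l := by positivity
              have a' : β ^ l * (((s.filter fun i => c (l + h) i = γ').card : ℝ) * β ^ h) ≤
                  β ^ l * ((so s).card : ℝ) := by
                have e : ((so s).card : ℝ) = ((s.filter fun i => c l i = γ s).card : ℝ) := by
                  simp only [hso, hs.1]
                rw [e]
                refine le_trans (le_of_eq (by ring)) (a.trans (le_of_eq ?_))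
                congr
              exact le_of_mul_le_mul_left a' bl) i (sg s) hsgs
            have c1 : ((so s).card : ℝ) / β ^ h ≤ 4 * (sg s).card / 72 := by
              gcongr
              exact_mod_cast hs.2.2
            have c2 : (2:ℝ) * ((sg s).filter fun j => near j i).card ≤ (sg s).card := by
              simp only [hnear, hsep]
              linarith
            have c3 : 2 * ((sg s).filter fun j => near j i).card ≤ (sg s).card := by
              exact_mod_cast c2
            convert c3)
          calc w s * ((sg s).card : ℝ) ^ 2
              ≤ w s * (2 * ∑ i ∈ sg s, (((sg s).filter fun j => ¬ near j i).card : ℝ)) := by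
                refine mul_le_mul_of_nonneg_left ?_ (w0 s)
                convert hfp; rfl
            _ = 2 * ∑ i0 ∈ sg s, ∑ i ∈ (sg s).filter (fun i => ¬ near i i0), w s := by
                simp only [Finset.sum_const, nsmul_eq_mul]
                rw [← Finset.sum_mul]; ring
            _ = 2 * ∑ i0 ∈ sg s, ∑ i ∈ (sg s).filter (fun i => ¬ near i i0),
                  (if (k s = l ∧ γ s = g) ∧ i ∈ s ∧ i0 ∈ s then w s else 0) := by
                congr 1
                refine Finset.sum_congr rfl fun i0 hi0 => Finset.sum_congr rfl fun i hi => ?_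
                rw [if_pos ⟨⟨hs.1, hs.2.1⟩, hsgs (Finset.mem_filter.1 hi).1, hsgs hi0⟩]
            _ ≤ _ := by
                have nn : ∀ i i0, 0 ≤ (if (k s = l ∧ γ s = g) ∧ i ∈ s ∧ i0 ∈ s then w s else 0) := by
                  intro i i0; split_ifs; exacts [w0 s, le_rfl]
                gcongr
                refine (Finset.sum_le_sum fun i0 _ => ?_).trans
                  (Finset.sum_le_sum_of_subset_of_nonneg hsgG'
                    fun i0 _ _ => Finset.sum_nonneg fun i _ => nn i i0)
                exact Finset.sum_le_sum_of_subset_of_nonneg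
                  (Finset.filter_subset_filter _ hsgG') fun i _ _ => nn i i0
        · rw [if_neg hs]
          refine mul_nonneg (by norm_num) (Finset.sum_nonneg fun i0 _ => Finset.sum_nonneg fun i _ => ?_)
          split_ifs; exacts [w0 s, le_rfl]
      refine (Finset.sum_le_sum fun s _ => step s).trans (le_of_eq ?_)
      rw [← Finset.mul_sum, Finset.sum_comm]
      congr 1
      refine Finset.sum_congr rfl fun i0 _ => ?_
      rw [Finset.sum_comm]
      refine Finset.sum_congr rfl fun i _ => ?_
      rw [← real_sig hYm μ (fun s => (k s = l ∧ γ s = g) ∧ i ∈ s ∧ i0 ∈ s)]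
      congr 1
      ext x
      simp only [hYk, hF, Set.mem_ofPred_eq, Set.mem_inter_iff, mem_sig]
      tauto
    have hTb : T * (τ * ρ0 / 2) ^ 2 ≤ (Real.sqrt (Fintype.card ι) * (2 * θ / δ)) *
        (432 * δ ^ 3 / sep * (μ.real F * (228096 * δ ^ 2 / ρ * (1 + Real.log (6 / δ))))) := by
      rw [hT, Finset.sum_mul]
      refine (Finset.sum_le_sum fun i0 _ => hhair i0).trans ?_
      rw [Finset.sum_const, nsmul_eq_mul]
      gcongr
    have hfin : 2 * T ≤ B1 * μ.real F := by
      have pos : 0 < (τ * ρ0 / 2) ^ 2 := by positivity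
      refine le_of_mul_le_mul_right ?_ pos
      calc 2 * T * (τ * ρ0 / 2) ^ 2 ≤ 2 * ((Real.sqrt (Fintype.card ι) * (2 * θ / δ)) *
        (432 * δ ^ 3 / sep * (μ.real F * (228096 * δ ^ 2 / ρ * (1 + Real.log (6 / δ)))))) := by
            linarith
        _ = B1 * μ.real F * (τ * ρ0 / 2) ^ 2 := by
            rw [hB1, hθ, hsep, pow_add]
            field_simp
            ring
    rw [← hFr]
    refine (hsum.trans hfin).trans ?_
    gcongr
    rw [hBdef]
    have : (0:ℝ) ≤ 256 * 16 ^ h := by positivity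
    linarith
  have hmain := comb_main w w0 K k γ (β ^ K)⁻¹ τ B (by positivity) hkK so sg y hyw m
    (fun i l => rfl) (fun s => rfl) (by
      intro s
      rw [inv_mul_le_iff₀ βK]
      convert hks s; rfl) hτ (by intro l g; convert hB l g)
  rw [huniv] at hmain
  refine le_trans ?_ hmain
  gcongr
  calc (Fintype.card ι : ℝ) * ρ0 = ∑ i : ι, ρ0 := by simp
    _ ≤ ∑ i, y i := Finset.sum_le_sum fun i _ => hY0 i

end core

def Ch (h : ℕ) : ℝ := 6912 * 2 ^ h * 228096 * 36 + 256 * 16 ^ h * 144 ^ 3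

lemma Ch_pos (h : ℕ) : 0 < Ch h := by unfold Ch; positivity

lemma fixed_arith (n δ ρ0 ρ τ L H a E : ℝ) (h j h' : ℕ) (hn : 1 ≤ n) (hδ : 0 < δ) (hρ0 : 0 < ρ0)
    (hτ : 0 < τ) (hτ1 : τ ≤ 1) (hL : 1 ≤ L) (hH : H = 2 ^ h') (hρ : ρ = 4 / 2 ^ (j + h'))
    (hj : ρ0 ≤ 36 * δ ^ 2 * (4 / 2 ^ j))
    (hmain : (a * (n * ρ0)) ^ 2 ≤ 16 * (6912 * 2 ^ h * Real.sqrt n * δ ^ 4 * 228096 * L /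
        (τ ^ 2 * ρ0 ^ 2 * ρ) + 256 * 16 ^ h) * E ^ 2) :
    a ^ 2 * τ ^ 2 * (n * Real.sqrt n) * ρ0 ^ 5 ≤ 16 * Ch h * H * δ ^ 6 * L * E ^ 2 := by
  have hH1 : 1 ≤ H := by rw [hH]; exact one_le_pow₀ (by norm_num)
  have hs1 : 1 ≤ Real.sqrt n := Real.one_le_sqrt.2 hn
  have hs2 : Real.sqrt n * Real.sqrt n = n := Real.mul_self_sqrt (by linarith)
  set q := Real.sqrt n
  have hq0 : 0 < q := by linarith
  set W := q * δ ^ 6 * H * L / (τ ^ 2 * ρ0 ^ 3) with hW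
  have hW0 : 0 < W := by positivity
  have e0 : ρ0 * 2 ^ j ≤ 144 * δ ^ 2 := by
    have : (36 * δ ^ 2 * (4 / 2 ^ j)) * 2 ^ j = 144 * δ ^ 2 := by field_simp; norm_num
    rw [← this]; gcongr
  have e1 : 6912 * 2 ^ h * q * δ ^ 4 * 228096 * L / (τ ^ 2 * ρ0 ^ 2 * ρ) ≤
      6912 * 2 ^ h * 228096 * 36 * W := by
    have : 6912 * 2 ^ h * q * δ ^ 4 * 228096 * L / (τ ^ 2 * ρ0 ^ 2 * ρ) =
       (6912 * 2 ^ h * 228096 * q * δ ^ 4 * L * H / (4 * τ ^ 2 * ρ0 ^ 3)) * (ρ0 * 2 ^ j) := by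
      rw [hρ, hH, pow_add]; field_simp
    rw [this]
    have : 6912 * 2 ^ h * 228096 * 36 * W =
      (6912 * 2 ^ h * 228096 * q * δ ^ 4 * L * H / (4 * τ ^ 2 * ρ0 ^ 3)) * (144 * δ ^ 2) := by
      rw [hW]; field_simp; norm_num
    rw [this]
    gcongr
  have e2 : (1:ℝ) ≤ 144 ^ 3 * W := by
    have a1 : ρ0 ≤ 144 * δ ^ 2 := by
      have : (1:ℝ) ≤ 2 ^ j := one_le_pow₀ (by norm_num)
      nlinarith
    have a2 : ρ0 ^ 3 ≤ 144 ^ 3 * δ ^ 6 := by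
      calc ρ0 ^ 3 ≤ (144 * δ ^ 2) ^ 3 := by gcongr
        _ = _ := by ring
    have a3 : τ ^ 2 ≤ 1 := by nlinarith
    have a4 : 1 ≤ q * H * L := by
      have : 1 ≤ q * H := by nlinarith
      nlinarith
    rw [hW, ← mul_div_assoc, le_div_iff₀ (by positivity)]
    calc 1 * (τ ^ 2 * ρ0 ^ 3) ≤ 1 * (1 * (144 ^ 3 * δ ^ 6)) := by gcongr
      _ ≤ (q * H * L) * (1 * (144 ^ 3 * δ ^ 6)) := by gcongr
      _ = _ := by ring
  have e3 : (a * (n * ρ0)) ^ 2 ≤ 16 * (Ch h * W) * E ^ 2 := by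
    refine hmain.trans ?_
    have : 256 * 16 ^ h ≤ 256 * 16 ^ h * (144 ^ 3 * W) := by
      have : (0:ℝ) < 256 * 16 ^ h := by positivity
      nlinarith
    gcongr
    unfold Ch; linarith
  have e4 : a ^ 2 * τ ^ 2 * (n * q) * ρ0 ^ 5 = (a * (n * ρ0)) ^ 2 * (τ ^ 2 * ρ0 ^ 3 / q) := by
    have : n = q * q := hs2.symm
    rw [this]; field_simp
  rw [e4]
  calc _ ≤ 16 * (Ch h * W) * E ^ 2 * (τ ^ 2 * ρ0 ^ 3 / q) := by gcongr
    _ = _ := by rw [hW]; field_simp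

theorem core_two {ι : Type*} [Fintype ι] [Nonempty ι] (μ : Measure (ℝ × ℝ × ℝ)) [IsFiniteMeasure μ]
    (hμ : μ ≤ volume) (δ : ℝ) (hδ : 0 < δ) (hδ1 : δ ≤ 1)
    (t0 v1 b1 v2 b2 : ι → ℝ) (z1 z2 : ι → ℤ)
    (hinj : ∀ i j, z1 i = z1 j → z2 i = z2 j → i = j)
    (h1 : ∀ i, δ * z1 i ≤ v1 i ∧ v1 i ≤ δ * z1 i + δ)
    (h2 : ∀ i, δ * z2 i ≤ v2 i ∧ v2 i ≤ δ * z2 i + δ)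
    (hb1 : ∀ i, -2 ≤ v1 i ∧ v1 i < 2) (hb2 : ∀ i, -2 ≤ v2 i ∧ v2 i < 2)
    (Y : ι → Set (ℝ × ℝ × ℝ)) (hYm : ∀ i, MeasurableSet (Y i))
    (hY : ∀ i, Y i ⊆ tb δ (t0 i) (v1 i) (b1 i) (v2 i) (b2 i))
    (τ ρ0 : ℝ) (hτ0 : 0 < τ) (hτ1 : τ ≤ 1) (hρ0 : 0 < ρ0)
    (K h J h' : ℕ) (βt : ℝ) (hβt : 1 ≤ βt)
    (hY0 : ∀ i, ρ0 * βt ^ J ≤ μ.real (Y i))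
    (hJ : ∀ j : ℕ, ρ0 * 2 ^ j ≤ 144 * δ ^ 2 → j + h' ≤ J)
    (hh' : 6 ≤ τ * βt ^ h')
    (hK1 : 1 ≤ δ * 2 ^ K) (hK2 : δ * 2 ^ K ≤ 2) (β : ℝ) (hβ : 1 ≤ β)
    (hh : 72 ≤ β ^ h) (hτ : 2 * (K + 1) * τ ≤ (β ^ K)⁻¹) :
    ((β ^ K)⁻¹) ^ 2 * τ ^ 2 * ((Fintype.card ι : ℝ) * Real.sqrt (Fintype.card ι)) * ρ0 ^ 5 ≤
      16 * Ch h * 2 ^ h' * δ ^ 6 * (1 + Real.log (6 / δ)) * (μ.real Set.univ) ^ 2 *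
        ((J + 1 : ℝ)) ^ 2 := by
  classical
  have ht := fun i => two_ends μ (Y i) (t0 i)
    (fun p hp => ⟨(hY i hp).1, (hY i hp).2.1⟩) J βt hβt
  choose jj nn hjJ hmass hends using ht
  set Y' : ι → Set (ℝ × ℝ × ℝ) := fun i => Y i ∩ {p | dc (jj i) (p.1 - t0 i) = nn i} with hY'
  have hY'0 : ∀ i, ρ0 ≤ μ.real (Y' i) := by
    intro i
    have a := (hY0 i).trans (hmass i)
    have b : 0 < βt ^ J := by positivity
    rw [mul_comm] at a
    exact le_of_mul_le_mul_left a b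
  -- choose the most popular scale
  set fib : ℕ → Finset ι := fun j => Finset.univ.filter fun i => jj i = j with hfib
  obtain ⟨j, hjm, hjmax⟩ := Finset.exists_max_image (Finset.range (J+1)) (fun j => (fib j).card)
    ⟨0, by simp⟩
  have hN : Fintype.card ι ≤ (J + 1) * (fib j).card := by
    rw [← Finset.card_univ]
    rw [Finset.card_eq_sum_card_fiberwise (f := jj) (t := Finset.range (J+1))
      (fun i _ => by simpa using Nat.lt_succ_of_le (hjJ i))]
    refine (Finset.sum_le_card_nsmul _ _ (fib j).card fun l hl => hjmax l hl).trans ?_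
    simp
  set ι' := {i : ι // jj i = j} with hι'
  have hcard : Fintype.card ι' = (fib j).card := Fintype.card_subtype _
  have hn1 : 1 ≤ Fintype.card ι' := by
    rw [hcard]
    have : 0 < Fintype.card ι := Fintype.card_pos
    by_contra hcon
    have : (fib j).card = 0 := by omega
    rw [this] at hN
    omega
  have hslab : ∀ i, jj i = j → ρ0 ≤ 36 * δ ^ 2 * (4 / 2 ^ j) := by
    intro i hi
    refine (hY'0 i).trans (real_le_of_vol hμ (by positivity) ?_)
    refine vol_slab δ (t0 i) (v1 i) (b1 i) (v2 i) (b2 i) hδ.le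
      (t0 i + nn i * (4 / 2 ^ j)) (4 / 2 ^ j) _ (Set.inter_subset_left.trans (hY i)) ?_
    rintro p ⟨-, hp⟩
    have := dc_bounds hp
    rw [hi] at this
    constructor <;> linarith [this.1, this.2]
  obtain ⟨i1, hi1⟩ : ∃ i, jj i = j := by
    obtain ⟨⟨i, hi⟩⟩ := Fintype.card_pos_iff.1 hn1
    exact ⟨i, hi⟩
  have hsl := hslab i1 hi1
  have hjh : j + h' ≤ J := by
    refine hJ j ?_
    have : (36 * δ ^ 2 * (4 / 2 ^ j)) * 2 ^ j = 144 * δ ^ 2 := by field_simp; norm_num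
    rw [← this]; gcongr
  set ρ : ℝ := 4 / 2 ^ (j + h') with hρ
  have hρpos : 0 < ρ := by positivity
  have hρ4 : ρ ≤ 4 := by
    rw [hρ]; exact div_le_self (by norm_num) (one_le_pow₀ (by norm_num))
  have hdm : ∀ i, MeasurableSet (Y' i) := fun i => (hYm i).inter (dc_measurable _ _ _)
  have hmain := core_disc (ι := ι') μ hμ δ ρ hδ hδ1 hρpos hρ4 (fun i => t0 i) (fun i => v1 i)
    (fun i => b1 i) (fun i => v2 i) (fun i => b2 i) (fun i => z1 i) (fun i => z2 i)
    (fun i i' e e' => Subtype.ext (hinj i i' e e')) (fun i => h1 i) (fun i => h2 i)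
    (fun i => hb1 i) (fun i => hb2 i) (fun i => Y' i) (fun i => hdm i)
    (fun i => Set.inter_subset_left.trans (hY i)) τ ρ0 hτ0 hρ0 (by
      rintro ⟨i, hi⟩ ts
      have a := hends i (j + h') hjh ts
      rw [hi, pow_add] at a
      have b : μ.real (Y' i ∩ {p | |p.1 - ts| < ρ}) ≤ μ.real (Y i ∩ {p | |p.1 - ts| < ρ}) :=
        measureReal_mono (Set.inter_subset_inter_left _ Set.inter_subset_left) (measure_ne_top _ _)
      have e : Y i ∩ {p | dc j (p.1 - t0 i) = nn i} = Y' i := by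
        simp only [hY', hi]
      rw [e] at a
      have hp : 0 < βt ^ j := by positivity
      set x := μ.real (Y i ∩ {p | |p.1 - ts| < 4 / 2 ^ (j + h')})
      have x0 : 0 ≤ x := measureReal_nonneg
      have a2 : βt ^ h' * x ≤ 3 * μ.real (Y' i) := by
        refine le_of_mul_le_mul_left ?_ hp
        linarith
      refine b.trans ?_
      change x ≤ _
      have a3 : 6 * x ≤ τ * (βt ^ h' * x) := by
        rw [← mul_assoc]; gcongr
      have a4 : τ * (βt ^ h' * x) ≤ τ * (3 * μ.real (Y' i)) := by gcongr
      linarith)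
    (fun i => hY'0 i) K h hK1 hK2 β hβ hh hτ
  have hlog : 0 ≤ Real.log (6/δ) := Real.log_nonneg (by rw [le_div_iff₀ hδ]; linarith)
  have hfa := fixed_arith (Fintype.card ι' : ℝ) δ ρ0 ρ τ (1 + Real.log (6 / δ)) (2 ^ h')
    ((β ^ K)⁻¹) (μ.real Set.univ) h j h' (by exact_mod_cast hn1) hδ hρ0 hτ0 hτ1 (by linarith)
    rfl hρ hsl hmain
  rw [hcard] at hfa
  set n : ℝ := ((fib j).card : ℝ) with hnn
  have hNr : (Fintype.card ι : ℝ) ≤ (J + 1) * n := by rw [hnn]; exact_mod_cast hN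
  have hJ1 : (1:ℝ) ≤ J + 1 := by linarith [Nat.cast_nonneg (α := ℝ) J]
  have hsq : Real.sqrt (Fintype.card ι) ≤ (J + 1) * Real.sqrt n := by
    refine Real.sqrt_le_iff.2 ⟨by positivity, ?_⟩
    rw [mul_pow, Real.sq_sqrt (by positivity)]
    refine hNr.trans ?_
    have : 0 ≤ n := by positivity
    have : (J + 1 : ℝ) ≤ (J + 1) ^ 2 := by nlinarith
    gcongr
  have hNN : (Fintype.card ι : ℝ) * Real.sqrt (Fintype.card ι) ≤
      (n * Real.sqrt n) * (J + 1 : ℝ) ^ 2 := by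
    calc (Fintype.card ι : ℝ) * Real.sqrt (Fintype.card ι)
        ≤ ((J + 1) * n) * ((J + 1) * Real.sqrt n) := by gcongr
      _ = _ := by ring
  have hβK : 0 < β ^ K := by positivity
  calc _ ≤ ((β ^ K)⁻¹) ^ 2 * τ ^ 2 * ((n * Real.sqrt n) * (J + 1 : ℝ) ^ 2) * ρ0 ^ 5 := by gcongr
    _ = ((β ^ K)⁻¹ ^ 2 * τ ^ 2 * (n * Real.sqrt n) * ρ0 ^ 5) * (J + 1 : ℝ) ^ 2 := by ring
    _ ≤ _ := by gcongr

lemma lin_le_pow (b : ℝ) (hb : 1 ≤ b) (M : ℕ) (hM : 0 < M) (hbM : b ^ M = 2) (K : ℕ) :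
    (K + 1 : ℝ) ≤ M * b ^ K := by
  have h1 : K < M * (K / M + 1) := Nat.lt_mul_div_succ K hM
  have h2 : (K + 1 : ℝ) ≤ M * ((K / M : ℕ) + 1 : ℝ) := by exact_mod_cast h1
  have h3 : ((K / M : ℕ) + 1 : ℝ) ≤ 2 ^ (K / M) := by
    exact_mod_cast (Nat.lt_two_pow_self : K / M < 2 ^ (K / M))
  have h4 : (2:ℝ) ^ (K / M) ≤ b ^ K := by
    rw [← hbM, ← pow_mul]
    exact pow_le_pow_right₀ hb (Nat.mul_div_le K M)
  calc (K + 1 : ℝ) ≤ M * ((K / M : ℕ) + 1 : ℝ) := h2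
    _ ≤ M * b ^ K := by gcongr; exact h3.trans h4

lemma core_J (b : ℝ) (hb : 1 ≤ b) (M : ℕ) (hM : 8 ≤ M) (hbM : b ^ M = 2) (K c1 j : ℕ) (δ lam ρ0 : ℝ)
    (hδ : 0 < δ) (hK1 : 1 ≤ δ * 2 ^ K) (hlam : δ ≤ lam)
    (hρ0 : ρ0 * b ^ (4 * K + (20 + 2 * c1)) = lam * δ ^ 2)
    (h : ρ0 * 2 ^ j ≤ 144 * δ ^ 2) :
    j + (c1 + 2 * (K / M + 1)) ≤ 4 * K + (20 + 2 * c1) := by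
  set J := 4 * K + (20 + 2 * c1) with hJ
  have hbJ : 0 < b ^ J := by positivity
  have h1 : lam * 2 ^ j ≤ 144 * b ^ J := by
    have : (lam * 2 ^ j) * δ ^ 2 ≤ (144 * b ^ J) * δ ^ 2 := by
      calc (lam * 2 ^ j) * δ ^ 2 = (ρ0 * 2 ^ j) * b ^ J := by linear_combination (-(2:ℝ) ^ j) * hρ0
        _ ≤ (144 * δ ^ 2) * b ^ J := by gcongr
        _ = _ := by ring
    exact le_of_mul_le_mul_right this (by positivity)
  have h2 : (2:ℝ) ^ j ≤ 144 * b ^ J * 2 ^ K := by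
    calc (2:ℝ) ^ j = 1 * 2 ^ j := by ring
      _ ≤ (δ * 2 ^ K) * 2 ^ j := by gcongr
      _ = (δ * 2 ^ j) * 2 ^ K := by ring
      _ ≤ (lam * 2 ^ j) * 2 ^ K := by gcongr
      _ ≤ _ := by gcongr
  have h3 : b ^ J ≤ 2 ^ (J / M + 1) := by
    rw [← hbM, ← pow_mul]
    exact pow_le_pow_right₀ hb (Nat.lt_mul_div_succ J (by omega)).le
  have h4 : (2:ℝ) ^ j ≤ 2 ^ (8 + (J / M + 1) + K) := by
    refine h2.trans ?_
    have e : (2:ℝ) ^ (8 + (J / M + 1) + K) = 256 * 2 ^ (J / M + 1) * 2 ^ K := by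
      rw [pow_add, pow_add 2 8]; norm_num
    rw [e]
    have : (144:ℝ) ≤ 256 := by norm_num
    gcongr
  have h5 : j ≤ 8 + (J / M + 1) + K := (pow_le_pow_iff_right₀ (by norm_num : (1:ℝ) < 2)).1 h4
  have h6 : J / M ≤ J / 8 := Nat.div_le_div_left hM (by norm_num)
  have h7 : K / M ≤ K / 8 := Nat.div_le_div_left hM (by norm_num)
  omega

lemma exists_K (δ : ℝ) (hδ : 0 < δ) (hδ1 : δ < 1) : ∃ K : ℕ, 1 ≤ δ * 2 ^ K ∧ δ * 2 ^ K ≤ 2 := by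
  obtain ⟨n, hn1, hn2⟩ := exists_nat_pow_near (x := 1 / δ) (y := 2)
    (by rw [le_div_iff₀ hδ]; linarith) (by norm_num)
  refine ⟨n + 1, ?_, ?_⟩
  · rw [div_lt_iff₀ hδ] at hn2; linarith
  · rw [le_div_iff₀ hδ] at hn1
    rw [pow_succ]; linarith

set_option maxHeartbeats 2000000 in
theorem core (ε : ℝ) (hε : 0 < ε) : ∃ C > (0:ℝ), ∀ (δ : ℝ), 0 < δ → δ < 1 →
    ∀ {ι : Type} [Fintype ι] (μ : Measure (ℝ × ℝ × ℝ)) [IsFiniteMeasure μ], μ ≤ volume →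
    ∀ (t0 v1 b1 v2 b2 : ι → ℝ) (z1 z2 : ι → ℤ),
    (∀ i j, z1 i = z1 j → z2 i = z2 j → i = j) →
    (∀ i, δ * z1 i ≤ v1 i ∧ v1 i ≤ δ * z1 i + δ) →
    (∀ i, δ * z2 i ≤ v2 i ∧ v2 i ≤ δ * z2 i + δ) →
    (∀ i, -2 ≤ v1 i ∧ v1 i < 2) → (∀ i, -2 ≤ v2 i ∧ v2 i < 2) →
    ∀ (Y : ι → Set (ℝ × ℝ × ℝ)), (∀ i, MeasurableSet (Y i)) →
    (∀ i, Y i ⊆ tb δ (t0 i) (v1 i) (b1 i) (v2 i) (b2 i)) →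
    ∀ lam : ℝ, 0 < lam → (∀ i, lam * δ ^ 2 ≤ μ.real (Y i)) →
    (Fintype.card ι : ℝ) * Real.sqrt (Fintype.card ι) * lam ^ 5 * δ ^ 4 ≤
      C * δ ^ (-ε) * (μ.real Set.univ) ^ 2 := by
  obtain ⟨M0, hM0⟩ := exists_nat_ge (31 / ε)
  obtain ⟨M, hMdef⟩ : ∃ x, x = M0 + 8 := ⟨_, rfl⟩
  have hM8 : 8 ≤ M := by omega
  have hMpos : (0:ℝ) < M := by positivity
  have hMε : (31:ℝ) / M ≤ ε := by
    rw [div_le_iff₀ hMpos]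
    rw [div_le_iff₀ hε] at hM0
    rw [hMdef]; push_cast; nlinarith
  obtain ⟨β, hβdef⟩ : ∃ x : ℝ, x = 2 ^ ((1:ℝ) / ((M ^ 2 : ℕ) : ℝ)) := ⟨_, rfl⟩
  have hβ1 : 1 ≤ β := by
    rw [hβdef]; exact Real.one_le_rpow (by norm_num) (by positivity)
  have hβM : β ^ (M ^ 2) = 2 := by
    rw [hβdef, ← Real.rpow_natCast, ← Real.rpow_mul (by norm_num), one_div, inv_mul_cancel₀, Real.rpow_one]
    positivity
  obtain ⟨b, hb⟩ : ∃ x, x = β ^ M := ⟨_, rfl⟩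
  have hb1 : 1 ≤ b := by rw [hb]; exact one_le_pow₀ hβ1
  have hbM : b ^ M = 2 := by rw [hb, ← pow_mul, ← sq, hβM]
  have hβb : β ≤ b := by rw [hb]; exact le_self_pow₀ hβ1 (by omega)
  have hbr : b = 2 ^ ((1:ℝ) / M) := by
    have : b = (b ^ M) ^ ((1:ℝ)/M) := by
      rw [← Real.rpow_natCast, ← Real.rpow_mul (by linarith), mul_one_div_cancel hMpos.ne', Real.rpow_one]
    rw [this, hbM]
  obtain ⟨c1, hc1⟩ : ∃ x, x = M * (12 * M ^ 2) := ⟨_, rfl⟩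
  obtain ⟨h, hh⟩ : ∃ x, x = 7 * M ^ 2 := ⟨_, rfl⟩
  obtain ⟨A, hA⟩ : ∃ x : ℝ, x = 16 * Ch h * (2 ^ (c1 + 2)) * 6 * (25 + 2 * c1) ^ 2 * 4 * b ^ (5 * (20 + 2 * c1)) * M ^ 5 := ⟨_, rfl⟩
  have hA0 : 0 < A := by have := Ch_pos h; rw [hA]; positivity
  refine ⟨216 + A * 2 ^ 31, by positivity, ?_⟩
  intro δ hδ hδ1 ι _ μ _ hμ t0 v1 b1 v2 b2 z1 z2 hinj h1 h2 hv1 hv2 Y hYm hY lam hlam hY0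
  have hδε : 1 ≤ δ ^ (-ε) := Real.one_le_rpow_of_pos_of_le_one_of_nonpos hδ hδ1.le (by linarith)
  rcases isEmpty_or_nonempty ι with hem | hne
  · simp only [Fintype.card_eq_zero, Nat.cast_zero, zero_mul]; positivity
  set N : ℝ := (Fintype.card ι : ℝ) with hN
  set E := μ.real Set.univ with hE
  have hE0 : 0 ≤ E := measureReal_nonneg
  have hElam : lam * δ ^ 2 ≤ E := by
    obtain ⟨i⟩ := hne
    exact (hY0 i).trans (measureReal_mono (Set.subset_univ _) (measure_ne_top _ _))
  by_cases hcase : lam ≤ δ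
  · have hN36 : N ≤ (6 / δ) ^ 2 := by
      have key : ∀ (v : ℝ) (z : ℤ), δ * z ≤ v ∧ v ≤ δ * z + δ → -2 ≤ v ∧ v < 2 →
          (-2 / δ - 1 ≤ z ∧ (z : ℝ) ≤ (-2 / δ - 1) + (4 / δ + 1)) := by
        intro v z hz hv
        constructor
        · rw [sub_le_iff_le_add, div_le_iff₀ hδ]; nlinarith [hz.2]
        · have : (-2 / δ - 1) + (4 / δ + 1) = 2 / δ := by ring
          rw [this, le_div_iff₀ hδ]; nlinarith [hz.1]
      have := pair_card Finset.univ z1 z2 hinj _ _ (4 / δ + 1) (by positivity)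
        (fun i _ => key _ _ (h1 i) (hv1 i)) (fun i _ => key _ _ (h2 i) (hv2 i))
      rw [Finset.card_univ] at this
      refine this.trans ?_
      have : 1 ≤ 1 / δ := by rw [le_div_iff₀ hδ]; linarith
      have e : 6 / δ = 4 / δ + 1 / δ + 1 / δ := by ring
      rw [e]; gcongr <;> linarith
    have hsq : Real.sqrt N ≤ 6 / δ := by
      rw [← Real.sqrt_sq (by positivity : 0 ≤ 6 / δ)]; exact Real.sqrt_le_sqrt hN36
    calc N * Real.sqrt N * lam ^ 5 * δ ^ 4 ≤ (6 / δ) ^ 2 * (6 / δ) * lam ^ 5 * δ ^ 4 := by gcongr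
      _ = 216 * (lam ^ 3 * lam ^ 2 * δ) := by field_simp; norm_num
      _ ≤ 216 * (δ ^ 3 * lam ^ 2 * δ) := by gcongr
      _ = 216 * (lam * δ ^ 2) ^ 2 := by ring
      _ ≤ 216 * E ^ 2 := by gcongr
      _ ≤ 216 * δ ^ (-ε) * E ^ 2 := by
          have : (216:ℝ) ≤ 216 * δ ^ (-ε) := by linarith
          gcongr
      _ ≤ _ := by
          gcongr
          have : 0 < A * 2 ^ 31 := by positivity
          linarith
  push Not at hcase
  obtain ⟨K, hK1, hK2⟩ := exists_K δ hδ hδ1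
  obtain ⟨h', hh'⟩ : ∃ x, x = c1 + 2 * (K / M + 1) := ⟨_, rfl⟩
  obtain ⟨J, hJ⟩ : ∃ x, x = 4 * K + (20 + 2 * c1) := ⟨_, rfl⟩
  have hbJ : 0 < b ^ J := by positivity
  have hβK : 0 < β ^ K := by positivity
  obtain ⟨ρ0, hρ0⟩ : ∃ x, x = lam * δ ^ 2 / b ^ J := ⟨_, rfl⟩
  have hrhoJ : ρ0 * b ^ J = lam * δ ^ 2 := by rw [hρ0]; field_simp
  obtain ⟨τ, hτ⟩ : ∃ x, x = (β ^ K)⁻¹ / (2 * (K + 1)) := ⟨_, rfl⟩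
  have hK0 : (0:ℝ) < K + 1 := by positivity
  have hβK1 : 1 ≤ β ^ K := one_le_pow₀ hβ1
  have hτ0 : 0 < τ := by rw [hτ]; positivity
  have hρ00 : 0 < ρ0 := by rw [hρ0]; positivity
  have hτ1 : τ ≤ 1 := by
    rw [hτ, div_le_one (by positivity)]
    have : (β ^ K)⁻¹ ≤ 1 := inv_le_one_of_one_le₀ hβK1
    have : (0:ℝ) ≤ K := by positivity
    linarith
  have hKβ : (K + 1 : ℝ) ≤ (M ^ 2 : ℕ) * β ^ K := lin_le_pow β hβ1 (M ^ 2) (by positivity) hβM K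
  have hKb : (K + 1 : ℝ) ≤ M * b ^ K := lin_le_pow b hb1 M (by omega) hbM K
  have hbh' : 6 ≤ τ * b ^ h' := by
    have e1 : (12 * M ^ 2 : ℝ) ≤ b ^ c1 := by
      rw [hc1, pow_mul, hbM]
      exact_mod_cast (Nat.lt_two_pow_self : 12 * M ^ 2 < 2 ^ (12 * M ^ 2)).le
    have e2 : β ^ K ≤ b ^ (K / M + 1) := by
      rw [hb, ← pow_mul]
      exact pow_le_pow_right₀ hβ1 (Nat.lt_mul_div_succ K (by omega)).le
    have e3 : b ^ h' = b ^ c1 * (b ^ (K / M + 1)) ^ 2 := by rw [hh', pow_add, ← pow_mul]; ring_nf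
    have e4 : 12 * (K + 1) * β ^ K ≤ b ^ h' := by
      rw [e3]
      calc 12 * (K + 1) * β ^ K ≤ 12 * ((M ^ 2 : ℕ) * β ^ K) * β ^ K := by gcongr
        _ = (12 * M ^ 2 : ℝ) * (β ^ K) ^ 2 := by push_cast; ring
        _ ≤ _ := by gcongr
    calc (6:ℝ) = τ * (12 * (K + 1) * β ^ K) := by rw [hτ]; field_simp; norm_num
      _ ≤ _ := by gcongr
  have hmain := core_two μ hμ δ hδ hδ1.le t0 v1 b1 v2 b2 z1 z2 hinj h1 h2 hv1 hv2 Y hYm hY τ ρ0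
    hτ0 hτ1 hρ00 K h J h' b hb1 (fun i => by rw [hrhoJ]; exact hY0 i)
    (fun j hj => by
      have := core_J b hb1 M hM8 hbM K c1 j δ lam ρ0 hδ hK1 hcase.le (by rw [← hJ]; exact hrhoJ) hj
      rw [hh', hJ]; exact this) hbh' hK1 hK2 β hβ1
    (by rw [hh, mul_comm, pow_mul, hβM]; norm_num)
    (by rw [hτ]; field_simp; exact le_rfl)
  -- collect the losses
  set L := 1 + Real.log (6 / δ) with hL
  have hL6 : L ≤ 6 * (K + 1) := by
    have a1 : 6 / δ ≤ 6 * 2 ^ K := by rw [div_le_iff₀ hδ]; nlinarith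
    have a2 : Real.log (6 / δ) ≤ Real.log (6 * 2 ^ K) := Real.log_le_log (by positivity) a1
    rw [Real.log_mul (by norm_num) (by positivity), Real.log_pow] at a2
    have a3 : Real.log 6 ≤ 5 := by have := Real.log_le_sub_one_of_pos (show (0:ℝ) < 6 by norm_num); linarith
    have a4 : Real.log 2 ≤ 1 := by have := Real.log_le_sub_one_of_pos (show (0:ℝ) < 2 by norm_num); linarith
    have a5 : (K:ℝ) * Real.log 2 ≤ K * 1 := by gcongr
    rw [hL]
    have : (0:ℝ) ≤ K := by positivity
    linarith
  have hL0 : 0 < L := by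
    have : 0 ≤ Real.log (6/δ) := Real.log_nonneg (by rw [le_div_iff₀ hδ]; linarith)
    rw [hL]; linarith
  have hJ1 : (J + 1 : ℝ) ≤ (25 + 2 * c1) * (K + 1) := by
    rw [hJ]; push_cast
    have : (0:ℝ) ≤ K := by positivity
    have : (0:ℝ) ≤ (c1:ℝ) * K := by positivity
    nlinarith
  have h2h' : (2:ℝ) ^ h' ≤ 2 ^ (c1 + 2) * b ^ (2 * K) := by
    have : h' = (c1 + 2) + 2 * (K / M) := by rw [hh']; ring
    rw [this, pow_add]
    gcongr
    rw [← hbM, ← pow_mul]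
    refine pow_le_pow_right₀ hb1 ?_
    have := Nat.mul_div_le K M
    nlinarith
  have hfin : N * Real.sqrt N * lam ^ 5 * δ ^ 4 ≤
      16 * Ch h * 2 ^ h' * L * (J + 1 : ℝ) ^ 2 * (4 * (K + 1) ^ 2 * (β ^ K) ^ 4 * (b ^ J) ^ 5) * E ^ 2 := by
    have pos : 0 < ((β ^ K)⁻¹) ^ 2 * τ ^ 2 / (b ^ J) ^ 5 * δ ^ 6 := by positivity
    refine le_of_mul_le_mul_left ?_ pos
    calc _ = ((β ^ K)⁻¹) ^ 2 * τ ^ 2 * (N * Real.sqrt N) * ρ0 ^ 5 := by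
          rw [hρ0]; field_simp
      _ ≤ 16 * Ch h * 2 ^ h' * δ ^ 6 * L * E ^ 2 * ((J + 1 : ℝ)) ^ 2 := hmain
      _ = _ := by rw [hτ]; field_simp; norm_num
  have hloss : 16 * Ch h * 2 ^ h' * L * (J + 1 : ℝ) ^ 2 * (4 * (K + 1) ^ 2 * (β ^ K) ^ 4 * (b ^ J) ^ 5)
      ≤ A * b ^ (31 * K) := by
    have := Ch_pos h
    calc 16 * Ch h * 2 ^ h' * L * (J + 1 : ℝ) ^ 2 * (4 * (K + 1) ^ 2 * (β ^ K) ^ 4 * (b ^ J) ^ 5)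
        ≤ 16 * Ch h * (2 ^ (c1 + 2) * b ^ (2 * K)) * (6 * (K + 1)) * ((25 + 2 * c1) * (K + 1)) ^ 2 *
          (4 * (K + 1) ^ 2 * (b ^ K) ^ 4 * (b ^ J) ^ 5) := by gcongr
      _ = 16 * Ch h * (2 ^ (c1 + 2) * b ^ (2 * K)) * 6 * (25 + 2 * c1) ^ 2 *
          (4 * (b ^ K) ^ 4 * (b ^ J) ^ 5) * (K + 1) ^ 5 := by ring
      _ ≤ 16 * Ch h * (2 ^ (c1 + 2) * b ^ (2 * K)) * 6 * (25 + 2 * c1) ^ 2 *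
          (4 * (b ^ K) ^ 4 * (b ^ J) ^ 5) * (M * b ^ K) ^ 5 := by gcongr
      _ = _ := by
        rw [hA, hJ]
        simp only [pow_add, pow_mul, mul_pow]
        ring
  have hbK : b ^ (31 * K) ≤ 2 ^ 31 * δ ^ (-ε) := by
    have e1 : b ^ (31 * K) = ((2:ℝ) ^ K) ^ ((31:ℝ) / M) := by
      rw [hbr, ← Real.rpow_natCast, ← Real.rpow_mul (by norm_num), ← Real.rpow_natCast 2 K,
        ← Real.rpow_mul (by norm_num)]
      congr 1; push_cast; ring
    rw [e1]
    have e2 : (2:ℝ) ^ K ≤ 2 * δ⁻¹ := by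
      rw [← div_eq_mul_inv, le_div_iff₀ hδ]; linarith
    have e3 : 1 ≤ δ⁻¹ := (one_le_inv₀ hδ).2 hδ1.le
    calc ((2:ℝ) ^ K) ^ ((31:ℝ) / M) ≤ (2 * δ⁻¹) ^ ((31:ℝ) / M) := by gcongr
      _ = 2 ^ ((31:ℝ) / M) * δ⁻¹ ^ ((31:ℝ) / M) := Real.mul_rpow (by norm_num) (by positivity)
      _ ≤ 2 ^ (31:ℝ) * δ⁻¹ ^ ε := by
          gcongr
          · norm_num
          · refine div_le_self (by norm_num) ?_
            exact_mod_cast (by omega : 1 ≤ M)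
      _ = _ := by
          rw [Real.inv_rpow hδ.le, Real.rpow_neg hδ.le]
          norm_num
  calc _ ≤ _ := hfin
    _ ≤ A * b ^ (31 * K) * E ^ 2 := by gcongr
    _ ≤ A * (2 ^ 31 * δ ^ (-ε)) * E ^ 2 := by gcongr
    _ = (A * 2 ^ 31) * δ ^ (-ε) * E ^ 2 := by ring
    _ ≤ _ := by gcongr; linarith

local notation "E3" => EuclideanSpace ℝ (Fin 3)

/-! ### coordinates -/

def Phi (i : Fin 3) (x : E3) : ℝ × ℝ × ℝ := (x i, x (i.succAbove 0), x (i.succAbove 1))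

lemma Phi_mp (i : Fin 3) : MeasurePreserving (Phi i) volume volume := by
  have h1 := PiLp.volume_preserving_ofLp (Fin 3)
  have h2 := volume_preserving_piFinSuccAbove (fun _ : Fin 3 => ℝ) i
  have h3 := volume_preserving_finTwoArrow ℝ
  have h4 : MeasurePreserving (Prod.map (id : ℝ → ℝ) (MeasurableEquiv.finTwoArrow (α := ℝ)))
      volume volume := (MeasurePreserving.id volume).prod h3
  exact h4.comp (h2.comp h1)

lemma norm_sq3 (i : Fin 3) (x : E3) :
    ‖x‖ ^ 2 = x i ^ 2 + x (i.succAbove 0) ^ 2 + x (i.succAbove 1) ^ 2 := by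
  rw [EuclideanSpace.norm_sq_eq, Fin.sum_univ_succAbove _ i, Fin.sum_univ_two]
  simp only [Real.norm_eq_abs, sq_abs]
  ring

lemma ext3 (i : Fin 3) {x y : E3} (h : x i = y i) (h0 : x (i.succAbove 0) = y (i.succAbove 0))
    (h1 : x (i.succAbove 1) = y (i.succAbove 1)) : x = y := by
  ext l
  revert l
  rw [Fin.forall_iff_succAbove i]
  refine ⟨h, ?_⟩
  intro l
  fin_cases l
  · exact h0
  · exact h1

def slope (i : Fin 3) (l : Fin 2) (ξ : E3) : ℝ := ξ (i.succAbove l) / ξ i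

lemma slope_bound {i : Fin 3} {ξ : E3} (hξ : ‖ξ‖ = 1) (hi : 1 / 2 ≤ |ξ i|) (l : Fin 2) :
    -2 ≤ slope i l ξ ∧ slope i l ξ < 2 := by
  have h := norm_sq3 i ξ
  rw [hξ] at h
  have h2 : (1:ℝ) / 4 ≤ ξ i ^ 2 := by rw [← sq_abs]; nlinarith
  have hne : ξ i ≠ 0 := by intro h0; rw [h0] at h2; norm_num at h2
  have h3 : ξ (i.succAbove l) ^ 2 ≤ 3 / 4 := by
    fin_cases l
    · show ξ (i.succAbove 0) ^ 2 ≤ 3 / 4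
      nlinarith [sq_nonneg (ξ (i.succAbove 1))]
    · show ξ (i.succAbove 1) ^ 2 ≤ 3 / 4
      nlinarith [sq_nonneg (ξ (i.succAbove 0))]
  have h4 : (slope i l ξ) ^ 2 ≤ 3 := by
    unfold slope
    rw [div_pow, div_le_iff₀ (by positivity)]; linarith
  constructor <;> nlinarith

lemma exists_coord {ξ : E3} (hξ : ‖ξ‖ = 1) : ∃ i, 1 / 2 ≤ |ξ i| := by
  by_contra hcon
  push Not at hcon
  have h := norm_sq3 0 ξ
  rw [hξ] at h
  have key : ∀ i, ξ i ^ 2 ≤ 1 / 4 := by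
    intro i
    rw [← sq_abs]
    nlinarith [hcon i, abs_nonneg (ξ i)]
  linarith [key 0, key ((0:Fin 3).succAbove 0), key ((0:Fin 3).succAbove 1)]

lemma tube_sub {δ : ℝ} (hδ : 0 < δ) (hδ1 : δ < 1) (i : Fin 3) {ξ : E3} (a : E3) (hξ : ‖ξ‖ = 1)
    (hi : 1 / 2 ≤ |ξ i|) :
    tube 3 δ ξ a ⊆ Phi i ⁻¹' (tb δ (a i - 2) (slope i 0 ξ)
      (a (i.succAbove 0) - a i * slope i 0 ξ) (slope i 1 ξ)
      (a (i.succAbove 1) - a i * slope i 1 ξ)) := by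
  rintro x ⟨hx1, hx2⟩
  set s := ⟪x - a, ξ⟫ with hs
  set w := (x - a) - s • ξ with hw
  have hne : ξ i ≠ 0 := by intro h0; rw [h0] at hi; norm_num at hi
  have hwc : ∀ l, |w l| ≤ δ := fun l => (PiLp.norm_apply_le w l).trans hx2
  have hwe : ∀ l, x l - a l = s * ξ l + w l := by
    intro l; simp [hw]
  have hξi : |ξ i| ≤ 1 := by rw [← hξ]; exact PiLp.norm_apply_le ξ i
  have ht : |x i - a i| ≤ 3 / 2 := by
    rw [hwe]
    refine (abs_add_le _ _).trans ?_
    rw [abs_mul]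
    have : |s| * |ξ i| ≤ 1 / 2 * 1 := by gcongr
    linarith [hwc i]
  have key : ∀ l : Fin 2, |x (i.succAbove l) - (a (i.succAbove l) - a i * slope i l ξ) -
      x i * slope i l ξ| ≤ 3 * δ := by
    intro l
    have hb := slope_bound hξ hi l
    have hab : |slope i l ξ| ≤ 2 := abs_le.2 ⟨hb.1, hb.2.le⟩
    have e0 : ξ (i.succAbove l) = ξ i * slope i l ξ := by unfold slope; field_simp
    have e : x (i.succAbove l) - (a (i.succAbove l) - a i * slope i l ξ) - x i * slope i l ξ =
        w (i.succAbove l) - w i * slope i l ξ := by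
      have e1 := hwe (i.succAbove l)
      have e2 := hwe i
      rw [e0] at e1
      linear_combination e1 - slope i l ξ * e2
    rw [e]
    refine (abs_sub _ _).trans ?_
    rw [abs_mul]
    have : |w i| * |slope i l ξ| ≤ δ * 2 := by gcongr; exact hwc i
    linarith [hwc (i.succAbove l)]
  obtain ⟨t1, t2⟩ := abs_le.1 ht
  refine ⟨?_, ?_, key 0, key 1⟩
  · show a i - 2 ≤ x i
    linarith
  · show x i < a i - 2 + 4
    linarith

lemma tube_vol {δ : ℝ} (hδ : 0 < δ) (hδ1 : δ < 1) (i : Fin 3) {ξ : E3} (a : E3) (hξ : ‖ξ‖ = 1)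
    (hi : 1 / 2 ≤ |ξ i|) : ENNReal.ofReal (δ ^ 2 / 64) ≤ volume (tube 3 δ ξ a) := by
  have hne : ξ i ≠ 0 := by intro h0; rw [h0] at hi; norm_num at hi
  set g : Fin 2 → ℝ → ℝ := fun l t => a (i.succAbove l) + (t - a i) * slope i l ξ with hg
  set A : Set ℝ := Icc (a i - 1/8) (a i + 1/8) with hA
  have hgm : ∀ l, Measurable (g l) := fun l => by simp only [hg]; fun_prop
  have hv := vol_box A measurableSet_Icc (g 0) (g 1) (hgm 0) (hgm 1) (δ / 8) (by positivity)
  set S : Set (ℝ × ℝ × ℝ) :=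
    {p | p.1 ∈ A ∧ |p.2.1 - g 0 p.1| ≤ δ / 8 ∧ |p.2.2 - g 1 p.1| ≤ δ / 8} with hS
  have hSm : MeasurableSet S := by
    have m1 : MeasurableSet {p : ℝ × ℝ × ℝ | p.1 ∈ A} := measurable_fst measurableSet_Icc
    have m2 : MeasurableSet {p : ℝ × ℝ × ℝ | |p.2.1 - g 0 p.1| ≤ δ / 8} := by
      simp only [hg]; exact measurableSet_le (by fun_prop) (by fun_prop)
    have m3 : MeasurableSet {p : ℝ × ℝ × ℝ | |p.2.2 - g 1 p.1| ≤ δ / 8} := by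
      simp only [hg]; exact measurableSet_le (by fun_prop) (by fun_prop)
    exact m1.inter (m2.inter m3)
  have hpre : volume (Phi i ⁻¹' S) = volume S := (Phi_mp i).measure_preimage hSm.nullMeasurableSet
  have hvol : volume S = ENNReal.ofReal (δ ^ 2 / 64) := by
    rw [hv, Real.volume_Icc, ← ENNReal.ofReal_mul (by positivity)]
    congr 1; ring
  rw [← hvol, ← hpre]
  refine measure_mono ?_
  rintro x ⟨hx1, hx2, hx3⟩
  set s := (x i - a i) / ξ i with hs
  set u := (x - a) - s • ξ with hu
  have hxi : |x i - a i| ≤ 1 / 8 := by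
    have : x i ∈ A := hx1
    rw [abs_le]; constructor <;> linarith [this.1, this.2]
  have u1 : u i = 0 := by simp [hu, hs]; field_simp; ring
  have ul : ∀ l, u (i.succAbove l) = x (i.succAbove l) - g l (x i) := by
    intro l; simp [hu, hs, hg, slope]; field_simp; ring
  have hu2 : ‖u‖ ≤ δ / 4 := by
    have h := norm_sq3 i u
    rw [u1, ul, ul] at h
    have a1 : (x (i.succAbove 0) - g 0 (x i)) ^ 2 ≤ (δ / 8) ^ 2 := sq_le_sq' (abs_le.1 hx2).1 (abs_le.1 hx2).2
    have a2 : (x (i.succAbove 1) - g 1 (x i)) ^ 2 ≤ (δ / 8) ^ 2 := sq_le_sq' (abs_le.1 hx3).1 (abs_le.1 hx3).2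
    refine abs_le_of_sq_le_sq' ?_ (by positivity) |>.2
    nlinarith
  have hs4 : |s| ≤ 1 / 4 := by
    rw [hs, abs_div, div_le_iff₀ (by positivity)]; linarith
  have hin : ⟪x - a, ξ⟫ = s + ⟪u, ξ⟫ := by
    have : x - a = s • ξ + u := by simp [hu]
    rw [this, inner_add_left, inner_smul_left, real_inner_self_eq_norm_sq, hξ]; simp
  have hui : |⟪u, ξ⟫| ≤ δ / 4 := by
    refine (abs_real_inner_le_norm _ _).trans ?_
    rw [hξ, mul_one]; exact hu2
  refine ⟨?_, ?_⟩
  · rw [hin]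
    refine (abs_add_le _ _).trans ?_
    linarith
  · have : (x - a) - ⟪x - a, ξ⟫ • ξ = u - ⟪u, ξ⟫ • ξ := by
      rw [hin, add_smul, hu]; abel
    rw [this]
    refine (norm_sub_le _ _).trans ?_
    rw [norm_smul, hξ, Real.norm_eq_abs]
    linarith

lemma kak_tube {δ α : ℝ} (hδ : 0 < δ) (hδ1 : δ < 1) (hα : 0 < α) (E : Set E3) (hE : MeasurableSet E)
    (hEf : volume E < ⊤) (i : Fin 3) {ξ : E3} (hξ : ‖ξ‖ = 1) (hi : 1 / 2 ≤ |ξ i|)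
    (hk : ENNReal.ofReal α < kakeyaMax 3 δ (E.indicator fun _ => (1 : ℝ)) ξ) :
    ∃ t0 b1 b2, α / 64 * δ ^ 2 ≤
      (((volume : Measure E3).restrict E).map (Phi i)).real
        (tb δ t0 (slope i 0 ξ) b1 (slope i 1 ξ) b2) := by
  obtain ⟨a, ha⟩ := lt_iSup_iff.1 hk
  have h1 := ENNReal.mul_lt_of_lt_div ha
  have h2 : ∫⁻ x in tube 3 δ ξ a, ENNReal.ofReal |E.indicator (fun _ => (1:ℝ)) x| =
      volume (E ∩ tube 3 δ ξ a) := by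
    have : (fun x => ENNReal.ofReal |E.indicator (fun _ => (1:ℝ)) x|) = E.indicator 1 := by
      ext x
      by_cases hx : x ∈ E <;> simp [hx]
    rw [this, lintegral_indicator_one hE, Measure.restrict_apply hE]
  rw [h2] at h1
  refine ⟨a i - 2, a (i.succAbove 0) - a i * slope i 0 ξ, a (i.succAbove 1) - a i * slope i 1 ξ, ?_⟩
  have hΦ := (Phi_mp i).measurable
  rw [measureReal_def, Measure.map_apply hΦ (meas_tb _ _ _ _ _ _)]
  have : IsFiniteMeasure ((volume : Measure E3).restrict E) := ⟨by simpa using hEf⟩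
  rw [← ENNReal.ofReal_le_iff_le_toReal (measure_ne_top _ _),
    Measure.restrict_apply (hΦ (meas_tb _ _ _ _ _ _))]
  calc ENNReal.ofReal (α / 64 * δ ^ 2) = ENNReal.ofReal α * ENNReal.ofReal (δ ^ 2 / 64) := by
        rw [← ENNReal.ofReal_mul hα.le]; congr 1; ring
    _ ≤ ENNReal.ofReal α * volume (tube 3 δ ξ a) := by gcongr; exact tube_vol hδ hδ1 i a hξ hi
    _ ≤ volume (E ∩ tube 3 δ ξ a) := h1.le
    _ ≤ _ := by
      refine measure_mono ?_
      rintro x ⟨hx1, hx2⟩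
      exact ⟨tube_sub hδ hδ1 i a hξ hi hx2, hx1⟩


/-! ### the measure of a cell of directions -/

def liftP (i : Fin 3) (v : Fin 2 → ℝ) : E3 := WithLp.toLp 2 (i.insertNth 1 v)

lemma liftP_self (i : Fin 3) (v : Fin 2 → ℝ) : liftP i v i = 1 := by simp [liftP]

lemma liftP_succ (i : Fin 3) (v : Fin 2 → ℝ) (l : Fin 2) : liftP i v (i.succAbove l) = v l := by
  simp [liftP]

lemma one_le_liftP (i : Fin 3) (v : Fin 2 → ℝ) : 1 ≤ ‖liftP i v‖ := by
  have h := norm_sq3 i (liftP i v)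
  rw [liftP_self] at h
  nlinarith [norm_nonneg (liftP i v), sq_nonneg (liftP i v (i.succAbove 0)),
    sq_nonneg (liftP i v (i.succAbove 1))]

lemma liftP_dist (i : Fin 3) (v w : Fin 2 → ℝ) : ‖liftP i v - liftP i w‖ ≤ 2 * dist v w := by
  have h := norm_sq3 i (liftP i v - liftP i w)
  simp only [PiLp.sub_apply, liftP_self, liftP_succ] at h
  have h0 : (v 0 - w 0) ^ 2 ≤ dist v w ^ 2 := by
    rw [← sq_abs, ← Real.dist_eq]; gcongr; exact dist_le_pi_dist v w 0
  have h1 : (v 1 - w 1) ^ 2 ≤ dist v w ^ 2 := by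
    rw [← sq_abs, ← Real.dist_eq]; gcongr; exact dist_le_pi_dist v w 1
  refine (abs_le_of_sq_le_sq' ?_ (by positivity)).2
  nlinarith

lemma normalize_dist {x y : E3} (hx : 1 ≤ ‖x‖) (hy : 1 ≤ ‖y‖) :
    ‖‖x‖⁻¹ • x - ‖y‖⁻¹ • y‖ ≤ 2 * ‖x - y‖ := by
  have hx0 : 0 < ‖x‖ := by linarith
  have hy0 : 0 < ‖y‖ := by linarith
  have e : ‖x‖⁻¹ • x - ‖y‖⁻¹ • y = ‖x‖⁻¹ • (x - y) + (‖x‖⁻¹ - ‖y‖⁻¹) • y := by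
    rw [smul_sub, sub_smul]; abel
  rw [e]
  refine (norm_add_le _ _).trans ?_
  rw [norm_smul, norm_smul, Real.norm_eq_abs, Real.norm_eq_abs, abs_of_pos (inv_pos.2 hx0)]
  have e2 : |‖x‖⁻¹ - ‖y‖⁻¹| * ‖y‖ = ‖x‖⁻¹ * |‖y‖ - ‖x‖| := by
    have : ‖x‖⁻¹ - ‖y‖⁻¹ = ‖x‖⁻¹ * (‖y‖ - ‖x‖) * ‖y‖⁻¹ := by field_simp
    rw [this, abs_mul, abs_mul, abs_of_pos (inv_pos.2 hx0), abs_of_pos (inv_pos.2 hy0)]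
    field_simp
  rw [e2]
  have h1 : ‖x‖⁻¹ ≤ 1 := inv_le_one_of_one_le₀ hx
  have h2 : |‖y‖ - ‖x‖| ≤ ‖x - y‖ := by rw [norm_sub_rev]; exact abs_norm_sub_norm_le y x
  have h3 : ‖x‖⁻¹ * ‖x - y‖ ≤ 1 * ‖x - y‖ := by gcongr
  have h4 : ‖x‖⁻¹ * |‖y‖ - ‖x‖| ≤ 1 * ‖x - y‖ := by gcongr
  linarith

def sphP (i : Fin 3) (s : ℝ) (v : Fin 2 → ℝ) : E3 := s • (‖liftP i v‖⁻¹ • liftP i v)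

lemma sphP_lip (i : Fin 3) {s : ℝ} (hs : |s| = 1) : LipschitzWith 4 (sphP i s) := by
  refine LipschitzWith.of_dist_le_mul ?_
  intro v w
  rw [dist_eq_norm, sphP, sphP, ← smul_sub, norm_smul, Real.norm_eq_abs, hs, one_mul]
  refine (normalize_dist (one_le_liftP i v) (one_le_liftP i w)).trans ?_
  have := liftP_dist i v w
  push_cast
  linarith

lemma eq_sphP {i : Fin 3} {ξ : E3} (hξ : ‖ξ‖ = 1) (hi : 1 / 2 ≤ |ξ i|) :
    ∃ s : ℝ, (s = 1 ∨ s = -1) ∧ ξ = sphP i s (fun l => slope i l ξ) := by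
  have h0 : ξ i ≠ 0 := by intro h; rw [h] at hi; norm_num at hi
  have e : ξ = ξ i • liftP i (fun l => slope i l ξ) := by
    refine ext3 i ?_ ?_ ?_
    · simp [liftP_self]
    · simp only [PiLp.smul_apply, liftP_succ, slope, smul_eq_mul]; field_simp
    · simp only [PiLp.smul_apply, liftP_succ, slope, smul_eq_mul]; field_simp
  have hn : |ξ i| * ‖liftP i (fun l => slope i l ξ)‖ = 1 := by
    rw [← Real.norm_eq_abs, ← norm_smul, ← e, hξ]
  have hinv : ‖liftP i (fun l => slope i l ξ)‖⁻¹ = |ξ i| := by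
    exact (eq_inv_of_mul_eq_one_left hn).symm
  rcases abs_choice (ξ i) with h | h
  · refine ⟨1, Or.inl rfl, ?_⟩
    rw [sphP, hinv, h, one_smul]; exact e
  · refine ⟨-1, Or.inr rfl, ?_⟩
    rw [sphP, hinv, h, neg_smul, neg_smul, smul_neg, neg_neg, one_smul]; exact e

lemma img_measure (i : Fin 3) {s : ℝ} (hs : |s| = 1) {δ : ℝ} (hδ : 0 < δ) (a : Fin 2 → ℝ) :
    μH[((3 : ℕ) : ℝ) - 1] (sphP i s '' Icc a (fun l => a l + δ)) ≤ ENNReal.ofReal (16 * δ ^ 2) := by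
  have h2 : ((3 : ℕ) : ℝ) - 1 = ((Fintype.card (Fin 2) : ℕ) : ℝ) := by norm_num
  rw [h2]
  have h := (sphP_lip i hs).hausdorffMeasure_image_le
    (d := ((Fintype.card (Fin 2) : ℕ) : ℝ)) (by positivity) (Icc a (fun l => a l + δ))
  refine h.trans ?_
  rw [hausdorffMeasure_pi_real, Real.volume_Icc_pi]
  simp only [add_sub_cancel_left, Finset.prod_const, Finset.card_univ, Fintype.card_fin]
  rw [ENNReal.ofReal_mul (by norm_num), ENNReal.ofReal_pow hδ.le]
  gcongr
  norm_num

def cell (i : Fin 3) (δ : ℝ) (z : ℤ × ℤ) : Set E3 :=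
  {ξ | ‖ξ‖ = 1 ∧ 1 / 2 ≤ |ξ i| ∧ ⌊slope i 0 ξ / δ⌋ = z.1 ∧ ⌊slope i 1 ξ / δ⌋ = z.2}

lemma floor_bd {δ v : ℝ} (hδ : 0 < δ) : δ * ⌊v / δ⌋ ≤ v ∧ v ≤ δ * ⌊v / δ⌋ + δ := by
  have h1 := Int.floor_le (v / δ)
  have h2 := (Int.lt_floor_add_one (v / δ)).le
  rw [le_div_iff₀ hδ] at h1
  rw [div_le_iff₀ hδ] at h2
  constructor <;> nlinarith

lemma cell_measure (i : Fin 3) {δ : ℝ} (hδ : 0 < δ) (z : ℤ × ℤ) :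
    μH[((3 : ℕ) : ℝ) - 1] (cell i δ z) ≤ ENNReal.ofReal (32 * δ ^ 2) := by
  set a : Fin 2 → ℝ := ![δ * z.1, δ * z.2] with ha
  have hsub : cell i δ z ⊆ sphP i 1 '' Icc a (fun l => a l + δ) ∪
      sphP i (-1) '' Icc a (fun l => a l + δ) := by
    rintro ξ ⟨h1, h2, h3, h4⟩
    obtain ⟨s, hs, e⟩ := eq_sphP h1 h2
    have hm : (fun l => slope i l ξ) ∈ Icc a (fun l => a l + δ) := by
      have f0 := floor_bd (v := slope i 0 ξ) hδ
      have f1 := floor_bd (v := slope i 1 ξ) hδ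
      rw [h3] at f0
      rw [h4] at f1
      constructor
      · intro l; fin_cases l
        · exact f0.1
        · exact f1.1
      · intro l; fin_cases l
        · exact f0.2
        · exact f1.2
    rcases hs with rfl | rfl
    · left; exact ⟨_, hm, e.symm⟩
    · right; exact ⟨_, hm, e.symm⟩
  refine (measure_mono hsub).trans ((measure_union_le _ _).trans ?_)
  refine (add_le_add (img_measure i (by norm_num) hδ a) (img_measure i (by norm_num) hδ a)).trans ?_
  rw [← ENNReal.ofReal_add (by positivity) (by positivity)]
  gcongr
  linarith

/-! ### the bound in a single chart -/

def bad (i : Fin 3) (δ α : ℝ) (E : Set E3) : Set E3 :=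
  {ξ | ‖ξ‖ = 1 ∧ 1 / 2 ≤ |ξ i| ∧
    ENNReal.ofReal α < kakeyaMax 3 δ (E.indicator fun _ => (1 : ℝ)) ξ}

lemma chart (ε : ℝ) (hε : 0 < ε) : ∃ C > (0 : ℝ), ∀ δ, 0 < δ → δ < 1 → ∀ E : Set E3,
    MeasurableSet E → volume E < ⊤ → ∀ α, 0 < α → ∀ i : Fin 3, ∃ N : ℕ,
    μH[((3 : ℕ) : ℝ) - 1] (bad i δ α E) ≤ ENNReal.ofReal (N * (32 * δ ^ 2)) ∧
    (N : ℝ) * √N * (α / 64) ^ 5 * δ ^ 4 ≤ C * δ ^ (-ε) * (volume E).toReal ^ 2 := by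
  obtain ⟨C, hC, H⟩ := core ε hε
  refine ⟨C, hC, ?_⟩
  intro δ hδ hδ1 E hE hEf α hα i
  set q : E3 → ℤ × ℤ := fun ξ => (⌊slope i 0 ξ / δ⌋, ⌊slope i 1 ξ / δ⌋) with hq
  have hfin : (q '' bad i δ α E).Finite := by
    refine ((Set.finite_Icc (⌊-2 / δ⌋) (⌊2 / δ⌋)).prod
      (Set.finite_Icc (⌊-2 / δ⌋) (⌊2 / δ⌋))).subset ?_
    rintro _ ⟨ξ, ⟨h1, h2, -⟩, rfl⟩
    have b0 := slope_bound h1 h2 0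
    have b1 := slope_bound h1 h2 1
    refine ⟨⟨?_, ?_⟩, ⟨?_, ?_⟩⟩
    · exact Int.floor_le_floor (by gcongr; exact b0.1)
    · exact Int.floor_le_floor (by gcongr; exact b0.2.le)
    · exact Int.floor_le_floor (by gcongr; exact b1.1)
    · exact Int.floor_le_floor (by gcongr; exact b1.2.le)
  set Z := hfin.toFinset with hZ
  refine ⟨Z.card, ?_, ?_⟩
  · have hsub : bad i δ α E ⊆ ⋃ z ∈ Z, cell i δ z := by
      intro ξ hξ
      simp only [mem_iUnion]
      exact ⟨q ξ, by rw [hZ, Set.Finite.mem_toFinset]; exact ⟨ξ, hξ, rfl⟩, hξ.1, hξ.2.1, rfl, rfl⟩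
    refine (measure_mono hsub).trans ((measure_biUnion_finset_le _ _).trans ?_)
    refine (Finset.sum_le_sum (fun z _ => cell_measure i hδ z)).trans ?_
    rw [Finset.sum_const, nsmul_eq_mul, ENNReal.ofReal_mul (p := (Z.card : ℝ)) (by positivity),
      ENNReal.ofReal_natCast]
  · have hch : ∀ z : Z, ∃ ξ, ξ ∈ bad i δ α E ∧ q ξ = z := by
      rintro ⟨z, hz⟩
      rw [hZ, Set.Finite.mem_toFinset] at hz
      obtain ⟨ξ, h, h'⟩ := hz
      exact ⟨ξ, h, h'⟩
    choose ξ hξ hqξ using hch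
    have ht : ∀ z : Z, ∃ t0 b1 b2, α / 64 * δ ^ 2 ≤
        (((volume : Measure E3).restrict E).map (Phi i)).real
        (tb δ t0 (slope i 0 (ξ z)) b1 (slope i 1 (ξ z)) b2) := fun z =>
      kak_tube hδ hδ1 hα E hE hEf i (hξ z).1 (hξ z).2.1 (hξ z).2.2
    choose t0 b1 b2 ht using ht
    have hΦ := (Phi_mp i).measurable
    have hf0 : IsFiniteMeasure ((volume : Measure E3).restrict E) := ⟨by simpa using hEf⟩
    have hle : ((volume : Measure E3).restrict E).map (Phi i) ≤ volume := by
      rw [← (Phi_mp i).map_eq]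
      exact Measure.map_mono Measure.restrict_le_self hΦ
    have huniv : (((volume : Measure E3).restrict E).map (Phi i)).real univ = (volume E).toReal := by
      rw [measureReal_def, Measure.map_apply hΦ MeasurableSet.univ]; simp
    have hz1 : ∀ z : Z, ⌊slope i 0 (ξ z) / δ⌋ = z.1.1 := fun z => congrArg Prod.fst (hqξ z)
    have hz2 : ∀ z : Z, ⌊slope i 1 (ξ z) / δ⌋ = z.1.2 := fun z => congrArg Prod.snd (hqξ z)
    have := H δ hδ hδ1 (ι := Z) (((volume : Measure E3).restrict E).map (Phi i)) hle
      t0 (fun z => slope i 0 (ξ z)) b1 (fun z => slope i 1 (ξ z)) b2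
      (fun z => z.1.1) (fun z => z.1.2)
      (fun z w h h' => Subtype.ext (Prod.ext h h'))
      (fun z => by have := floor_bd (v := slope i 0 (ξ z)) hδ; rwa [hz1 z] at this)
      (fun z => by have := floor_bd (v := slope i 1 (ξ z)) hδ; rwa [hz2 z] at this)
      (fun z => slope_bound (hξ z).1 (hξ z).2.1 0)
      (fun z => slope_bound (hξ z).1 (hξ z).2.1 1)
      (fun z => tb δ (t0 z) (slope i 0 (ξ z)) (b1 z) (slope i 1 (ξ z)) (b2 z))
      (fun z => meas_tb _ _ _ _ _ _) (fun z => subset_rfl) (α / 64) (by positivity) ht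
    rwa [huniv, Fintype.card_coe] at this

lemma pow_step {N C α δ V ε : ℝ} (hN : 0 ≤ N) (hC : 0 < C) (hα : 0 < α) (hδ : 0 < δ) (hV : 0 ≤ V)
    (h : N * √N * (α / 64) ^ 5 * δ ^ 4 ≤ C * δ ^ (-(5 * ε)) * V ^ 2) :
    α ^ (10 / 3 : ℝ) * (N * (32 * δ ^ 2)) ≤
      32 * (64 : ℝ) ^ (10 / 3 : ℝ) * C ^ (2 / 3 : ℝ) *
        (δ ^ (-(1 / 5 : ℝ) - ε) * V ^ (2 / 5 : ℝ)) ^ (10 / 3 : ℝ) := by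
  have h' := Real.rpow_le_rpow (by positivity) h (show (0 : ℝ) ≤ 2 / 3 by norm_num)
  have eN : (N * √N) ^ (2 / 3 : ℝ) = N := by
    rcases hN.eq_or_lt with rfl | hN
    · simp
    · rw [Real.sqrt_eq_rpow, ← Real.rpow_one_add' hN.le (by norm_num), ← Real.rpow_mul hN.le]
      norm_num
  have e5 : ((α / 64) ^ 5) ^ (2 / 3 : ℝ) = α ^ (10 / 3 : ℝ) / 64 ^ (10 / 3 : ℝ) := by
    rw [← Real.div_rpow hα.le (by norm_num), ← Real.rpow_natCast, ← Real.rpow_mul (by positivity)]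
    norm_num
  have e4 : (δ ^ 4) ^ (2 / 3 : ℝ) = δ ^ 2 * δ ^ (2 / 3 : ℝ) := by
    rw [← Real.rpow_natCast, ← Real.rpow_natCast, ← Real.rpow_mul hδ.le, ← Real.rpow_add hδ]
    norm_num
  have eV : (V ^ 2) ^ (2 / 3 : ℝ) = (V ^ (2 / 5 : ℝ)) ^ (10 / 3 : ℝ) := by
    rw [← Real.rpow_natCast, ← Real.rpow_mul hV, ← Real.rpow_mul hV]
    norm_num
  have eδ : (δ ^ (-(5 * ε))) ^ (2 / 3 : ℝ) =
      δ ^ (2 / 3 : ℝ) * (δ ^ (-(1 / 5 : ℝ) - ε)) ^ (10 / 3 : ℝ) := by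
    rw [← Real.rpow_mul hδ.le, ← Real.rpow_mul hδ.le, ← Real.rpow_add hδ]
    congr 1; ring
  rw [Real.mul_rpow (by positivity) (by positivity), Real.mul_rpow (by positivity) (by positivity),
    eN, Real.mul_rpow (by positivity) (by positivity), Real.mul_rpow (by positivity) (by positivity),
    e5, e4, eV, eδ] at h'
  rw [Real.mul_rpow (by positivity) (by positivity)]
  have hd : 0 < δ ^ (2 / 3 : ℝ) := by positivity
  have h64 : (0:ℝ) < 64 ^ (10 / 3 : ℝ) := by positivity
  set X := (δ ^ (-(1 / 5 : ℝ) - ε)) ^ (10 / 3 : ℝ)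
  set W := (V ^ (2 / 5 : ℝ)) ^ (10 / 3 : ℝ)
  set K := (64:ℝ) ^ (10 / 3 : ℝ)
  set D := δ ^ (2 / 3 : ℝ)
  set A := α ^ (10 / 3 : ℝ)
  set c := C ^ (2 / 3 : ℝ)
  have h2 : N * A * δ ^ 2 / K ≤ c * X * W := by
    refine le_of_mul_le_mul_left ?_ hd
    calc D * (N * A * δ ^ 2 / K) = N * (A / K) * (δ ^ 2 * D) := by ring
      _ ≤ _ := h'
      _ = _ := by ring
  rw [div_le_iff₀ h64] at h2
  nlinarith

lemma final : ∀ ε > (0 : ℝ), ∃ C > (0 : ℝ), ∀ δ : ℝ, δ ∈ Set.Ioo (0 : ℝ) 1 →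
      ∀ E : Set (EuclideanSpace ℝ (Fin 3)), MeasurableSet E → volume E < ⊤ →
        ∀ α : ℝ, 0 < α →
          ENNReal.ofReal α ^ (10 / 3 : ℝ) *
              sphereMeasure 3
                {ξ | ENNReal.ofReal α < kakeyaMax 3 δ (E.indicator fun _ => (1 : ℝ)) ξ} ≤
            (ENNReal.ofReal (C * δ ^ (-(1 / 5 : ℝ) - ε)) * volume E ^ (2 / 5 : ℝ)) ^
              (10 / 3 : ℝ) := by
  intro ε hε
  obtain ⟨C, hC, H⟩ := chart (5 * ε) (by positivity)
  set K : ℝ := 3 * (32 * (64 : ℝ) ^ (10 / 3 : ℝ) * C ^ (2 / 3 : ℝ)) with hK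
  have hK0 : 0 < K := by positivity
  refine ⟨K ^ (3 / 10 : ℝ), by positivity, ?_⟩
  rintro δ ⟨hδ, hδ1⟩ E hE hEf α hα
  set V := (volume E).toReal with hV
  have hV0 : 0 ≤ V := ENNReal.toReal_nonneg
  set R : ℝ := 32 * (64 : ℝ) ^ (10 / 3 : ℝ) * C ^ (2 / 3 : ℝ) *
        (δ ^ (-(1 / 5 : ℝ) - ε) * V ^ (2 / 5 : ℝ)) ^ (10 / 3 : ℝ) with hR
  have hR0 : 0 ≤ R := by positivity
  have hrhs : (ENNReal.ofReal (K ^ (3 / 10 : ℝ) * δ ^ (-(1 / 5 : ℝ) - ε)) *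
      volume E ^ (2 / 5 : ℝ)) ^ (10 / 3 : ℝ) = ENNReal.ofReal (3 * R) := by
    rw [← ENNReal.ofReal_toReal hEf.ne, ← hV, ENNReal.ofReal_rpow_of_nonneg hV0 (by norm_num),
      ← ENNReal.ofReal_mul (by positivity), ENNReal.ofReal_rpow_of_nonneg (by positivity)
        (by norm_num)]
    congr 1
    rw [mul_assoc, Real.mul_rpow (by positivity) (by positivity), ← Real.rpow_mul hK0.le, hR, hK]
    norm_num
    ring
  have hlhs : ENNReal.ofReal α ^ (10 / 3 : ℝ) = ENNReal.ofReal (α ^ (10 / 3 : ℝ)) :=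
    ENNReal.ofReal_rpow_of_pos hα
  have hb : ∀ i, ENNReal.ofReal (α ^ (10 / 3 : ℝ)) * μH[((3 : ℕ) : ℝ) - 1] (bad i δ α E) ≤
      ENNReal.ofReal R := by
    intro i
    obtain ⟨N, h1, h2⟩ := H δ hδ hδ1 E hE hEf α hα i
    calc _ ≤ ENNReal.ofReal (α ^ (10 / 3 : ℝ)) * ENNReal.ofReal (N * (32 * δ ^ 2)) := by gcongr
      _ = ENNReal.ofReal (α ^ (10 / 3 : ℝ) * (N * (32 * δ ^ 2))) := by
        rw [← ENNReal.ofReal_mul (by positivity)]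
      _ ≤ _ := ENNReal.ofReal_le_ofReal (pow_step (by positivity) hC hα hδ hV0 h2)
  rw [hrhs, hlhs, sphereMeasure, Measure.restrict_apply' isClosed_sphere.measurableSet]
  have hsub : {ξ | ENNReal.ofReal α < kakeyaMax 3 δ (E.indicator fun _ => (1 : ℝ)) ξ} ∩
      sphere (0 : E3) 1 ⊆ ⋃ i ∈ (Finset.univ : Finset (Fin 3)), bad i δ α E := by
    rintro ξ ⟨h1, h2⟩
    have hn : ‖ξ‖ = 1 := by simpa using h2
    obtain ⟨i, hi⟩ := exists_coord hn
    simp only [mem_iUnion]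
    exact ⟨i, Finset.mem_univ i, hn, hi, h1⟩
  calc _ ≤ ENNReal.ofReal (α ^ (10 / 3 : ℝ)) *
        ∑ i : Fin 3, μH[((3 : ℕ) : ℝ) - 1] (bad i δ α E) := by
        gcongr
        exact (measure_mono hsub).trans (measure_biUnion_finset_le _ _)
    _ ≤ ∑ i : Fin 3, ENNReal.ofReal R := by
        rw [Finset.mul_sum]; exact Finset.sum_le_sum (fun i _ => hb i)
    _ = ENNReal.ofReal (3 * R) := by
        rw [ENNReal.ofReal_mul (p := (3 : ℝ)) (by norm_num), Finset.sum_const]; simp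

end Kak

/-- **Restricted weak-type estimate.** For every `ε > 0` there exists `C_ε > 0` such that for
every `δ ∈ (0,1)`, every measurable `E ⊆ ℝ³` of finite measure and every `α > 0`:
`α^{10/3} · σ({ξ ∈ S² : (χ_E)*_δ(ξ) > α}) ≤ (C_ε δ^{-1/5-ε} |E|^{2/5})^{10/3}`. -/
theorem restricted_weak_type_estimate :
    ∀ ε > (0 : ℝ), ∃ C > (0 : ℝ), ∀ δ : ℝ, δ ∈ Set.Ioo (0 : ℝ) 1 →
      ∀ E : Set (EuclideanSpace ℝ (Fin 3)), MeasurableSet E → volume E < ⊤ →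
        ∀ α : ℝ, 0 < α →
          ENNReal.ofReal α ^ (10 / 3 : ℝ) *
              sphereMeasure 3
                {ξ | ENNReal.ofReal α < kakeyaMax 3 δ (E.indicator fun _ => (1 : ℝ)) ξ} ≤
            (ENNReal.ofReal (C * δ ^ (-(1 / 5 : ℝ) - ε)) * volume E ^ (2 / 5 : ℝ)) ^
              (10 / 3 : ℝ) := by
  exact Kak.final
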